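/- arXiv:1304.4813 — 2 statements merged into one kernel-verified Lean document; each statement's English description precedes it below -/
import Mathlib

section
/- For every integer n ≥ 4 one has the identity (in ℚ): Σ_{π ∈ Π_n} croc(π) = (n/2)·B_{n+1} + (3n/2)·B_n − (n(4n+1)/2)·B_{n−1} − n(n−1)·B_{n−2} + C(n,4)·B_{n−4}, where C(n,4) is a binomial coefficient. Equivalently, the average number of circular crossings in a random set partition of [n] equals this quantity divided by B_n. -/
open scoped Classical

def seg (n : ℕ) : Finset ℕ := Finset.Icc 1 n

def IsPartition (P : Finset (Finset ℕ)) (S : Finset ℕ) : Prop :=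
  ∅ ∉ P ∧ (∀ B ∈ P, ∀ C ∈ P, B ≠ C → Disjoint B C) ∧ P.biUnion id = S

noncomputable def partitions (n : ℕ) : Finset (Finset (Finset ℕ)) :=
  ((seg n).powerset.powerset).filter fun P => IsPartition P (seg n)

noncomputable def partitionsK (n k : ℕ) : Finset (Finset (Finset ℕ)) :=
  (partitions n).filter fun P => P.card = k

noncomputable def bell (n : ℕ) : ℕ := (partitions n).card

noncomputable def stirling (n k : ℕ) : ℕ := (partitionsK n k).card

/-- `(i, j)` is an edge of the set partition `P`. -/
def IsEdge (P : Finset (Finset ℕ)) (i j : ℕ) : Prop :=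
  i < j ∧ ∃ B ∈ P, i ∈ B ∧ j ∈ B ∧ ∀ p ∈ B, ¬(i < p ∧ p < j)

/-- `crol P`: number of linear crossings. -/
noncomputable def crol (P : Finset (Finset ℕ)) : ℕ :=
  Nat.card {e : (ℕ × ℕ) × ℕ × ℕ //
    IsEdge P e.1.1 e.1.2 ∧ IsEdge P e.2.1 e.2.2 ∧
      e.1.1 < e.2.1 ∧ e.2.1 < e.1.2 ∧ e.1.2 < e.2.2}

/-- `(i, j)` is a circular edge of `P`. -/
def IsCircEdge (P : Finset (Finset ℕ)) (i j : ℕ) : Prop :=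
  IsEdge P i j ∨
    ∃ B ∈ P, ∃ h : B.Nonempty, 2 ≤ B.card ∧ i = B.min' h ∧ j = B.max' h

/-- `croc P`: number of circular crossings. -/
noncomputable def croc (P : Finset (Finset ℕ)) : ℕ :=
  Nat.card {e : (ℕ × ℕ) × ℕ × ℕ //
    IsCircEdge P e.1.1 e.1.2 ∧ IsCircEdge P e.2.1 e.2.2 ∧
      e.1.1 < e.2.1 ∧ e.2.1 < e.1.2 ∧ e.1.2 < e.2.2}

/-- Two blocks overlap: `min B < min B' < max B < max B'`. -/
def Overlap (B B' : Finset ℕ) : Prop :=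
  ∃ (h : B.Nonempty) (h' : B'.Nonempty),
    B.min' h < B'.min' h' ∧ B'.min' h' < B.max' h ∧ B.max' h < B'.max' h'

/-- `ov P`: number of (unordered) pairs of blocks of `P` that overlap. -/
noncomputable def ov (P : Finset (Finset ℕ)) : ℕ :=
  Nat.card {p : Finset ℕ × Finset ℕ // p.1 ∈ P ∧ p.2 ∈ P ∧ Overlap p.1 p.2}

/-- Two blocks embrace: `min B < min B' ≤ max B' < max B`. -/
def Embrace (B B' : Finset ℕ) : Prop :=
  ∃ (h : B.Nonempty) (h' : B'.Nonempty),
    B.min' h < B'.min' h' ∧ B'.min' h' ≤ B'.max' h' ∧ B'.max' h' < B.max' h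

noncomputable def emb (P : Finset (Finset ℕ)) : ℕ :=
  Nat.card {p : Finset ℕ × Finset ℕ // p.1 ∈ P ∧ p.2 ∈ P ∧ Embrace p.1 p.2}

/-- The block of `P` containing `i`. -/
noncomputable def blockOf (P : Finset (Finset ℕ)) (i : ℕ) : Finset ℕ :=
  (P.filter fun B => i ∈ B).biUnion id

/-- The restricted growth function of `P`: `rgf P i = j` iff `i` lies in the `j`-th
block of `P`, the blocks being ordered by increasing minima. -/
noncomputable def rgf (P : Finset (Finset ℕ)) (i : ℕ) : ℕ :=
  (P.filter fun B => B.min ≤ (blockOf P i).min).card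

/-- A 2-pattern: a word on `{1,2}` containing both letters. -/
def TwoPattern {r : ℕ} (σ : Fin r → ℕ) : Prop :=
  (∀ t, σ t = 1 ∨ σ t = 2) ∧ (∃ t, σ t = 1) ∧ (∃ t, σ t = 2)

/-- `occ n σ P`: number of occurrences of the 2-pattern `σ` in the partition `P` of `[n]`. -/
noncomputable def occ (n : ℕ) {r : ℕ} (σ : Fin r → ℕ) (P : Finset (Finset ℕ)) : ℕ :=
  Nat.card {i : Fin r → ℕ // StrictMono i ∧ (∀ t, i t ∈ seg n) ∧
    ∃ a b : ℕ, a < b ∧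
      ∀ t, (σ t = 1 → rgf P (i t) = a) ∧ (σ t = 2 → rgf P (i t) = b)}

/-- Carlitz `q`-Stirling polynomials. -/
noncomputable def qS : ℕ → ℕ → Polynomial ℚ
  | 0, 0 => 1
  | 0, _ + 1 => 0
  | _ + 1, 0 => 0
  | n + 1, k + 1 =>
      Polynomial.X ^ k * qS n k +
        (∑ i ∈ Finset.range (k + 1), Polynomial.X ^ i) * qS n (k + 1)

/-- Standardization: the order preserving bijection `S → [|S|]`. -/
def stdMap (S : Finset ℕ) (a : ℕ) : ℕ := (S.filter fun x => x ≤ a).card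

/-- The standardized 2-block partition obtained from two blocks `A, B`. -/
def stdPair (A B : Finset ℕ) : Finset (Finset ℕ) :=
  {A.image (stdMap (A ∪ B)), B.image (stdMap (A ∪ B))}

namespace CircularCrossings

open Finset

/-- The set partitions of a finite set `S`. -/
noncomputable def parts (S : Finset ℕ) : Finset (Finset (Finset ℕ)) :=
  S.powerset.powerset.filter fun P => IsPartition P S

theorem mem_parts {S : Finset ℕ} {P : Finset (Finset ℕ)} : P ∈ parts S ↔ IsPartition P S := by
  simp only [parts, mem_filter, mem_powerset, and_iff_right_iff_imp]
  rintro ⟨-, -, rfl⟩ B hB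
  exact mem_powerset.2 (subset_biUnion_of_mem id hB)

theorem isPartition_erase {S A : Finset ℕ} {P : Finset (Finset ℕ)} (hP : IsPartition P S)
    (hA : A ∈ P) : IsPartition (P.erase A) (S \ A) := by
  obtain ⟨h0, hd, hu⟩ := hP
  refine ⟨fun h => h0 (mem_of_mem_erase h),
    fun B hB C hC => hd B (mem_of_mem_erase hB) C (mem_of_mem_erase hC), ?_⟩
  ext x
  simp only [← hu, mem_biUnion, mem_erase, mem_sdiff, id]
  constructor
  · rintro ⟨B, ⟨hne, hB⟩, hx⟩
    exact ⟨⟨B, hB, hx⟩, disjoint_left.1 (hd B hB A hA hne) hx⟩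
  · rintro ⟨⟨B, hB, hx⟩, hxA⟩
    exact ⟨B, ⟨by rintro rfl; exact hxA hx, hB⟩, hx⟩

theorem isPartition_insert {S A : Finset ℕ} {Q : Finset (Finset ℕ)}
    (hQ : IsPartition Q (S \ A)) (hA : A ⊆ S) (hne : A ≠ ∅) :
    IsPartition (insert A Q) S ∧ A ∉ Q := by
  obtain ⟨h0, hd, hu⟩ := hQ
  have hdis : ∀ B ∈ Q, Disjoint A B := fun B hB => by
    have hBu : B ⊆ S \ A := hu ▸ subset_biUnion_of_mem id hB
    exact disjoint_sdiff.mono_right hBu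
  refine ⟨⟨?_, ?_, ?_⟩, fun h => hne (disjoint_self.1 (hdis A h))⟩
  · simp only [mem_insert, not_or]
    exact ⟨fun h => hne h.symm, h0⟩
  · intro B hB C hC hBC
    rcases mem_insert.1 hB with hBA | hBQ <;> rcases mem_insert.1 hC with hCA | hCQ
    · exact absurd (hBA.trans hCA.symm) hBC
    · exact hBA ▸ hdis C hCQ
    · exact hCA ▸ (hdis B hBQ).symm
    · exact hd B hBQ C hCQ hBC
  · rw [biUnion_insert, hu, id, union_sdiff_of_subset hA]

/-- Summing over a partition together with one of its blocks amounts to summing over the block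
and a partition of its complement. -/
theorem sum_parts_sum_block {S : Finset ℕ} (F : Finset ℕ → Finset (Finset ℕ) → ℚ)
    (hF : ∀ Q, F ∅ Q = 0) :
    ∑ P ∈ parts S, ∑ A ∈ P, F A (P.erase A) =
      ∑ A ∈ S.powerset, ∑ Q ∈ parts (S \ A), F A Q := by
  rw [← sum_erase S.powerset (a := ∅) (sum_eq_zero fun Q _ => hF Q), sum_sigma', sum_sigma']
  refine sum_bij' (fun x _ => ⟨x.2, x.1.erase x.2⟩) (fun y _ => ⟨insert y.1 y.2, y.1⟩)
    ?_ ?_ ?_ ?_ ?_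
  · rintro ⟨P, A⟩ h
    simp only [mem_sigma, mem_parts, mem_erase, mem_powerset] at h ⊢
    refine ⟨⟨fun h0 => h.1.1 (h0 ▸ h.2), ?_⟩, isPartition_erase h.1 h.2⟩
    rw [← h.1.2.2]
    exact subset_biUnion_of_mem id h.2
  · rintro ⟨A, Q⟩ h
    simp only [mem_sigma, mem_parts, mem_erase, mem_powerset] at h ⊢
    exact ⟨(isPartition_insert h.2 h.1.2 h.1.1).1, mem_insert_self _ _⟩
  · rintro ⟨P, A⟩ h
    simp only [mem_sigma] at h
    simp [insert_erase h.2]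
  · rintro ⟨A, Q⟩ h
    simp only [mem_sigma, mem_parts, mem_erase, mem_powerset] at h
    simp [erase_insert (isPartition_insert h.2 h.1.2 h.1.1).2]
  · rintro ⟨P, A⟩ _
    rfl

/-- The block indicators of a property forcing membership of a fixed point add up to the
indicator of the existence of such a block. -/
theorem sum_block_indicator {S : Finset ℕ} {P : Finset (Finset ℕ)} (hP : IsPartition P S)
    (p : Finset ℕ → Prop) [DecidablePred p] (i : ℕ) (hp : ∀ A, p A → i ∈ A) :
    (∑ A ∈ P, if p A then (1 : ℚ) else 0) = if ∃ A ∈ P, p A then 1 else 0 := by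
  split_ifs with h
  · obtain ⟨A, hA, hpA⟩ := h
    rw [sum_eq_single_of_mem A hA, if_pos hpA]
    intro B hB hBA
    rw [if_neg]
    exact fun hpB => disjoint_left.1 (hP.2.1 B hB A hA hBA) (hp B hpB) (hp A hpA)
  · push Not at h
    exact sum_eq_zero fun A hA => if_neg (h A hA)

theorem card_parts (S : Finset ℕ) : (parts S).card = Nat.bell S.card := by
  induction S using Finset.strongInduction with
  | H S ih =>
    rcases S.eq_empty_or_nonempty with rfl | ⟨a, ha⟩
    · have : parts ∅ = {∅} := by
        ext P
        simp only [mem_parts, mem_singleton]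
        constructor
        · rintro ⟨h0, -, hu⟩
          refine eq_empty_of_forall_notMem fun B hB => h0 ?_
          have : B ⊆ ∅ := hu ▸ subset_biUnion_of_mem id hB
          rwa [subset_empty.1 this] at hB
        · rintro rfl
          exact ⟨by simp, by simp, by simp⟩
      simp [this]
    · have key : ((parts S).card : ℚ) =
          ∑ A ∈ S.powerset, if a ∈ A then ((parts (S \ A)).card : ℚ) else 0 := by
        have h := sum_parts_sum_block (S := S) (fun A _ => if a ∈ A then (1 : ℚ) else 0)
          (by simp)
        rw [card_eq_sum_ones, Nat.cast_sum]
        convert h using 1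
        · refine sum_congr rfl fun P hP => ?_
          have hP := mem_parts.1 hP
          rw [← hP.2.2] at ha
          rw [sum_block_indicator hP (fun A => a ∈ A) a fun _ h => h, if_pos (by simpa using ha)]
          simp
        · refine sum_congr rfl fun A _ => ?_
          split_ifs <;> simp
      have hS : insert a (S.erase a) = S := insert_erase ha
      rw [← hS, sum_powerset_insert (notMem_erase a S), hS] at key
      have h1 : ∑ A ∈ (S.erase a).powerset,
          (if a ∈ A then ((parts (S \ A)).card : ℚ) else 0) = 0 :=
        sum_eq_zero fun A hA => if_neg fun h => notMem_erase a S (mem_powerset.1 hA h)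
      have h2 : ∀ A ∈ (S.erase a).powerset,
          (if a ∈ insert a A then ((parts (S \ insert a A)).card : ℚ) else 0) =
            Nat.bell ((S.erase a).card - A.card) := fun A hA => by
        have hlt : S \ insert a A ⊂ S :=
          (ssubset_iff_of_subset sdiff_subset).2 ⟨a, ha, by simp⟩
        rw [if_pos (mem_insert_self a A), ih _ hlt, sdiff_insert, ← erase_sdiff_comm,
          card_sdiff_of_subset (mem_powerset.1 hA)]
      rw [h1, zero_add, sum_congr rfl h2,
        sum_powerset_apply_card (fun k => (Nat.bell ((S.erase a).card - k) : ℚ))] at key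
      have hc : S.card = (S.erase a).card + 1 := (card_erase_add_one ha).symm
      rw [hc, Nat.bell_succ, ← Nat.range_succ_eq_Iic]
      simp only [nsmul_eq_mul] at key
      exact_mod_cast key

theorem bell_eq (n : ℕ) : bell n = Nat.bell n := by
  have : partitions n = parts (seg n) := rfl
  rw [bell, this, card_parts, seg, Nat.card_Icc, Nat.add_sub_cancel]

/-- Summing a statistic over all ordered pairs of distinct blocks of all partitions. -/
theorem sum_parts_sum_pair {S : Finset ℕ} (f : Finset ℕ → Finset ℕ → ℚ)
    (h1 : ∀ D, f ∅ D = 0) (h2 : ∀ A, f A ∅ = 0) :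
    ∑ P ∈ parts S, ∑ A ∈ P, ∑ D ∈ P.erase A, f A D =
      ∑ A ∈ S.powerset, ∑ D ∈ (S \ A).powerset, f A D * Nat.bell ((S \ A) \ D).card := by
  rw [sum_parts_sum_block (fun A Q => ∑ D ∈ Q, f A D) (by simp [h1])]
  refine sum_congr rfl fun A _ => ?_
  rw [sum_parts_sum_block (fun D _ => f A D) (by simp [h2])]
  refine sum_congr rfl fun D _ => ?_
  rw [sum_const, card_parts, nsmul_eq_mul, mul_comm]

/-- A block-level description of circular edges. -/
def IsBlockEdge (A : Finset ℕ) (i j : ℕ) : Prop :=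
  i ∈ A ∧ j ∈ A ∧ ((∀ p ∈ A, ¬(i < p ∧ p < j)) ∨ ∀ p ∈ A, i ≤ p ∧ p ≤ j)

theorem isCircEdge_iff {P : Finset (Finset ℕ)} {i j : ℕ} (hij : i < j) :
    IsCircEdge P i j ↔ ∃ A ∈ P, IsBlockEdge A i j := by
  constructor
  · rintro (⟨-, A, hA, hi, hj, h⟩ | ⟨A, hA, hne, -, rfl, rfl⟩)
    · exact ⟨A, hA, hi, hj, Or.inl h⟩
    · exact ⟨A, hA, A.min'_mem hne, A.max'_mem hne,
        Or.inr fun p hp => ⟨A.min'_le p hp, A.le_max' p hp⟩⟩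
  · rintro ⟨A, hA, hi, hj, h | h⟩
    · exact Or.inl ⟨hij, A, hA, hi, hj, h⟩
    · have hne : A.Nonempty := ⟨i, hi⟩
      refine Or.inr ⟨A, hA, hne, one_lt_card.2 ⟨i, hi, j, hj, hij.ne⟩, ?_, ?_⟩
      · exact le_antisymm (A.le_min' hne i fun p hp => (h p hp).1) (A.min'_le i hi)
      · exact le_antisymm (A.le_max' j hj) (A.max'_le hne j fun p hp => (h p hp).2)

theorem isBlockEdge_disjoint {A : Finset ℕ} {a b c d : ℕ} (hab : a < b) (hbc : b < c)
    (hcd : c < d) (h : IsBlockEdge A a c) (h' : IsBlockEdge A b d) : False := by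
  obtain ⟨ha, hc, h | h⟩ := h
  · exact h b h'.1 ⟨hab, hbc⟩
  · exact absurd (h d h'.2.1).2 (by omega)

/-- The increasing quadruples `a < b < c < d` in `[n]`, stored as `((a, c), (b, d))`. -/
def quads (n : ℕ) : Finset ((ℕ × ℕ) × ℕ × ℕ) :=
  ((seg n ×ˢ seg n) ×ˢ seg n ×ˢ seg n).filter fun e =>
    e.1.1 < e.2.1 ∧ e.2.1 < e.1.2 ∧ e.1.2 < e.2.2

theorem mem_quads {n : ℕ} {e : (ℕ × ℕ) × ℕ × ℕ} : e ∈ quads n ↔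
    1 ≤ e.1.1 ∧ e.1.1 < e.2.1 ∧ e.2.1 < e.1.2 ∧ e.1.2 < e.2.2 ∧ e.2.2 ≤ n := by
  simp only [quads, seg, mem_filter, mem_product, mem_Icc]
  omega

theorem isCircEdge_mem_seg {n : ℕ} {P : Finset (Finset ℕ)} (hP : IsPartition P (seg n))
    {i j : ℕ} (h : IsCircEdge P i j) : i ∈ seg n ∧ j ∈ seg n := by
  have key : ∀ A ∈ P, A ⊆ seg n := fun A hA => hP.2.2 ▸ subset_biUnion_of_mem id hA
  rcases h with ⟨-, A, hA, hi, hj, -⟩ | ⟨A, hA, hne, -, rfl, rfl⟩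
  · exact ⟨key A hA hi, key A hA hj⟩
  · exact ⟨key A hA (A.min'_mem hne), key A hA (A.max'_mem hne)⟩

theorem boole_and (p q : Prop) [Decidable p] [Decidable q] [Decidable (p ∧ q)] :
    (if p ∧ q then (1 : ℚ) else 0) = (if p then 1 else 0) * if q then 1 else 0 := by
  split_ifs <;> first | tauto | simp

theorem croc_eq_sum {n : ℕ} {P : Finset (Finset ℕ)} (hP : IsPartition P (seg n)) :
    (croc P : ℚ) = ∑ e ∈ quads n, ∑ A ∈ P, ∑ D ∈ P.erase A,
      if IsBlockEdge A e.1.1 e.1.2 ∧ IsBlockEdge D e.2.1 e.2.2 then (1 : ℚ) else 0 := by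
  have h1 : croc P = ((quads n).filter fun e =>
      IsCircEdge P e.1.1 e.1.2 ∧ IsCircEdge P e.2.1 e.2.2).card := by
    rw [croc]
    apply Nat.subtype_card
    intro e
    simp only [mem_filter, mem_quads]
    constructor
    · tauto
    · rintro ⟨h, h', h3⟩
      have := isCircEdge_mem_seg hP h
      have := isCircEdge_mem_seg hP h'
      simp only [seg, mem_Icc] at *
      exact ⟨by omega, h, h'⟩
  rw [h1, ← sum_boole]
  refine sum_congr rfl fun e he => ?_
  obtain ⟨-, hab, hbc, hcd, -⟩ := mem_quads.1 he
  rw [isCircEdge_iff (hab.trans hbc), isCircEdge_iff (hbc.trans hcd), boole_and,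
    ← sum_block_indicator hP (fun A => IsBlockEdge A e.1.1 e.1.2) e.1.1 fun A h => h.1,
    ← sum_block_indicator hP (fun A => IsBlockEdge A e.2.1 e.2.2) e.2.1 fun A h => h.1,
    sum_mul_sum]
  refine sum_congr rfl fun A _ => ?_
  rw [sum_erase]
  · exact sum_congr rfl fun D _ => (boole_and _ _).symm
  · exact if_neg fun h => isBlockEdge_disjoint hab hbc hcd h.1 h.2

theorem sum_croc (n : ℕ) :
    ∑ P ∈ partitions n, (croc P : ℚ) = ∑ e ∈ quads n, ∑ A ∈ (seg n).powerset,
      ∑ D ∈ (seg n \ A).powerset,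
        (if IsBlockEdge A e.1.1 e.1.2 ∧ IsBlockEdge D e.2.1 e.2.2 then (1 : ℚ) else 0) *
          Nat.bell ((seg n \ A) \ D).card := by
  have h : partitions n = parts (seg n) := rfl
  rw [h, sum_congr rfl fun P hP => croc_eq_sum (mem_parts.1 hP), sum_comm]
  refine sum_congr rfl fun e _ => ?_
  exact sum_parts_sum_pair
    (fun A D => if IsBlockEdge A e.1.1 e.1.2 ∧ IsBlockEdge D e.2.1 e.2.2 then (1 : ℚ) else 0)
    (by simp [IsBlockEdge]) (by simp [IsBlockEdge])

/-- The umbral functional `X ^ k ↦ bell k`. -/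
noncomputable def umbral : Polynomial ℚ →ₗ[ℚ] ℚ :=
  Polynomial.lsum fun k => (Nat.bell k : ℚ) • LinearMap.id

theorem umbral_X_pow (k : ℕ) : umbral (Polynomial.X ^ k) = Nat.bell k := by
  rw [umbral, Polynomial.X_pow_eq_monomial, Polynomial.lsum_apply, Polynomial.sum_monomial_index]
    <;> simp

theorem umbral_X_add_one_pow (k : ℕ) :
    umbral ((Polynomial.X + 1) ^ k) = Nat.bell (k + 1) := by
  rw [add_comm, add_pow, map_sum, Nat.bell_succ, ← Nat.range_succ_eq_Iic]
  push_cast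
  refine sum_congr rfl fun i _ => ?_
  rw [one_pow, one_mul, mul_comm, ← nsmul_eq_mul, map_nsmul, umbral_X_pow, nsmul_eq_mul]

theorem umbral_X_mul (p : Polynomial ℚ) :
    umbral (Polynomial.X * p) = umbral (p.comp (Polynomial.X + 1)) := by
  induction p using Polynomial.induction_on' with
  | add p q hp hq => rw [mul_add, map_add, hp, hq, Polynomial.add_comp, map_add]
  | monomial k c =>
    rw [← Polynomial.C_mul_X_pow_eq_monomial, Polynomial.mul_comp, Polynomial.C_comp,
      Polynomial.X_pow_comp, ← Polynomial.smul_eq_C_mul, ← Polynomial.smul_eq_C_mul,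
      mul_smul_comm, map_smul, map_smul, umbral_X_add_one_pow, ← pow_succ', umbral_X_pow]

theorem umbral_X_add_two_pow (k : ℕ) :
    umbral ((Polynomial.X + 2) ^ k) = Nat.bell (k + 2) - Nat.bell (k + 1) := by
  have h := umbral_X_mul ((Polynomial.X + 1) ^ k)
  have h2 : ((Polynomial.X + 1 : Polynomial ℚ) ^ k).comp (Polynomial.X + 1) =
      (Polynomial.X + 2) ^ k := by
    rw [Polynomial.pow_comp, Polynomial.add_comp, Polynomial.X_comp, Polynomial.one_comp]
    ring
  have h3 : (Polynomial.X : Polynomial ℚ) * (Polynomial.X + 1) ^ k =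
      (Polynomial.X + 1) ^ (k + 1) - (Polynomial.X + 1) ^ k := by ring
  rw [← h2, ← h, h3, map_sub, umbral_X_add_one_pow, umbral_X_add_one_pow]

/-- Generating polynomial of the pairs of disjoint subsets `A ∋ a, c` and `D ∋ b, d` of `S`. -/
theorem sum_pair_weight {S : Finset ℕ} {a b c d : ℕ} (hab : a < b) (hbc : b < c) (hcd : c < d)
    (ha : a ∈ S) (hb : b ∈ S) (hc : c ∈ S) (hd : d ∈ S) (u v : ℕ → Polynomial ℚ) :
    ∑ A ∈ S.powerset, ∑ D ∈ (S \ A).powerset,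
      (if (a ∈ A ∧ c ∈ A) ∧ b ∈ D ∧ d ∈ D then
        (∏ p ∈ A, u p) * (∏ p ∈ D, v p) * Polynomial.X ^ ((S \ A) \ D).card else 0) =
    ∏ p ∈ S, if p = a ∨ p = c then u p else if p = b ∨ p = d then v p
      else u p + (v p + Polynomial.X) := by
  have h : ∀ p ∈ S, (if p = a ∨ p = c then u p else if p = b ∨ p = d then v p
      else u p + (v p + Polynomial.X)) =
      (if p = b ∨ p = d then 0 else u p) + (if p = a ∨ p = c then 0 else 1) *
        (v p + if p = b ∨ p = d then 0 else Polynomial.X) := by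
    intro p _
    split_ifs <;> first | omega | ring
  rw [prod_congr rfl h, prod_add]
  refine sum_congr rfl fun A hA => ?_
  rw [prod_mul_distrib, prod_add, mul_sum, mul_sum]
  refine sum_congr rfl fun D hD => ?_
  rw [mem_powerset] at hA hD
  split_ifs with hm
  · obtain ⟨⟨haA, hcA⟩, hbD, hdD⟩ := hm
    have hbA := (mem_sdiff.1 (hD hbD)).2
    have hdA := (mem_sdiff.1 (hD hdD)).2
    have e1 : ∏ p ∈ A, (if p = b ∨ p = d then 0 else u p) = ∏ p ∈ A, u p :=
      prod_congr rfl fun p hp => if_neg (by rintro (rfl | rfl) <;> contradiction)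
    have e2 : ∏ p ∈ S \ A, (if p = a ∨ p = c then (0 : Polynomial ℚ) else 1) = 1 :=
      prod_eq_one fun p hp => if_neg (by
        rintro (rfl | rfl) <;> exact (mem_sdiff.1 hp).2 (by assumption))
    have e3 : ∏ p ∈ (S \ A) \ D, (if p = b ∨ p = d then 0 else (Polynomial.X : Polynomial ℚ)) =
        Polynomial.X ^ ((S \ A) \ D).card :=
      prod_eq_pow_card fun p hp => if_neg (by
        rintro (rfl | rfl) <;> exact (mem_sdiff.1 hp).2 (by assumption))
    rw [e1, e2, e3]
    ring
  · symm
    by_cases hac : a ∈ A ∧ c ∈ A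
    · by_cases hbd : b ∈ A ∨ d ∈ A
      · have : ∏ p ∈ A, (if p = b ∨ p = d then 0 else u p) = 0 := by
          rcases hbd with h | h
          · exact prod_eq_zero h (by simp)
          · exact prod_eq_zero h (by simp)
        rw [this, zero_mul]
      · have : ∏ p ∈ (S \ A) \ D, (if p = b ∨ p = d then 0 else (Polynomial.X : Polynomial ℚ))
            = 0 := by
          rcases (by tauto : b ∉ D ∨ d ∉ D) with h | h
          · exact prod_eq_zero (i := b) (by simp only [mem_sdiff]; tauto) (by simp)
          · exact prod_eq_zero (i := d) (by simp only [mem_sdiff]; tauto) (by simp)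
        rw [this]
        ring
    · have : ∏ p ∈ S \ A, (if p = a ∨ p = c then (0 : Polynomial ℚ) else 1) = 0 := by
        rcases (by tauto : a ∉ A ∨ c ∉ A) with h | h
        · exact prod_eq_zero (i := a) (by simp only [mem_sdiff]; tauto) (by simp)
        · exact prod_eq_zero (i := c) (by simp only [mem_sdiff]; tauto) (by simp)
      rw [this]
      ring

/-- The weight equal to `1` at `i` and `j`, to `x` strictly between them and to `y` elsewhere. -/
noncomputable def edgeWeight (x y : Polynomial ℚ) (i j p : ℕ) : Polynomial ℚ :=
  if p = i ∨ p = j then 1 else if i < p ∧ p < j then x else y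

/-- The inside values of the three kinds of edge weights (no other point inside the edge, no other
point outside it, no other point at all). -/
noncomputable def insideValue : Fin 3 → Polynomial ℚ := ![0, 1, 0]

/-- The outside values of the three kinds of edge weights. -/
noncomputable def outsideValue : Fin 3 → Polynomial ℚ := ![1, 0, 0]

/-- The signs of the three kinds of edge weights in the inclusion-exclusion formula for the
indicator of a circular edge. -/
noncomputable def edgeSign : Fin 3 → Polynomial ℚ := ![1, 1, -1]

theorem prod_edgeWeight_outside {A : Finset ℕ} {i j : ℕ} :
    ∏ p ∈ A, edgeWeight 0 1 i j p = if ∀ p ∈ A, ¬(i < p ∧ p < j) then 1 else 0 := by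
  rw [← prod_boole]
  refine prod_congr rfl fun p _ => ?_
  unfold edgeWeight
  split_ifs <;> first | rfl | omega

theorem prod_edgeWeight_inside {A : Finset ℕ} {i j : ℕ} (hij : i < j) :
    ∏ p ∈ A, edgeWeight 1 0 i j p = if ∀ p ∈ A, i ≤ p ∧ p ≤ j then 1 else 0 := by
  rw [← prod_boole]
  refine prod_congr rfl fun p _ => ?_
  unfold edgeWeight
  split_ifs <;> first | rfl | omega

theorem prod_edgeWeight_endpoints {A : Finset ℕ} {i j : ℕ} :
    ∏ p ∈ A, edgeWeight 0 0 i j p = if ∀ p ∈ A, p = i ∨ p = j then 1 else 0 := by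
  rw [← prod_boole]
  refine prod_congr rfl fun p _ => ?_
  unfold edgeWeight
  split_ifs <;> rfl

theorem isBlockEdge_indicator {A : Finset ℕ} {i j : ℕ} (hij : i < j) (hi : i ∈ A) (hj : j ∈ A) :
    (if IsBlockEdge A i j then (1 : Polynomial ℚ) else 0) =
      ∑ k : Fin 3, edgeSign k * ∏ p ∈ A, edgeWeight (insideValue k) (outsideValue k) i j p := by
  have h : (∀ p ∈ A, p = i ∨ p = j) ↔
      (∀ p ∈ A, ¬(i < p ∧ p < j)) ∧ ∀ p ∈ A, i ≤ p ∧ p ≤ j := by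
    rw [← forall₂_and]
    refine forall₂_congr fun p _ => ?_
    omega
  simp only [Fin.sum_univ_three, edgeSign, insideValue, outsideValue, Matrix.cons_val,
    prod_edgeWeight_outside, prod_edgeWeight_inside hij, prod_edgeWeight_endpoints, h]
  simp only [IsBlockEdge, hi, hj, true_and]
  by_cases h1 : ∀ p ∈ A, ¬(i < p ∧ p < j) <;> by_cases h2 : ∀ p ∈ A, i ≤ p ∧ p ≤ j
  · rw [if_pos (Or.inl h1), if_pos h1, if_pos h2, if_pos ⟨h1, h2⟩]; ring
  · rw [if_pos (Or.inl h1), if_pos h1, if_neg h2, if_neg (h2 ·.2)]; ring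
  · rw [if_pos (Or.inr h2), if_neg h1, if_pos h2, if_neg (h1 ·.1)]; ring
  · rw [if_neg (not_or.2 ⟨h1, h2⟩), if_neg h1, if_neg h2, if_neg (h1 ·.1)]; ring

/-- A product over `[n]` of a weight which is constant on the gaps of an increasing quadruple. -/
theorem prod_seg_of_gaps {R : Type*} [CommMonoid R] {n a b c d : ℕ} (ha : 1 ≤ a) (hab : a < b)
    (hbc : b < c) (hcd : c < d) (hd : d ≤ n) (f : ℕ → R) (g : Fin 5 → R)
    (h : ∀ p, f p = if p = a ∨ p = b ∨ p = c ∨ p = d then 1 else if p < a then g 0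
      else if p < b then g 1 else if p < c then g 2 else if p < d then g 3 else g 4) :
    ∏ p ∈ seg n, f p = g 0 ^ (a - 1) * g 1 ^ (b - 1 - a) * g 2 ^ (c - 1 - b) *
      g 3 ^ (d - 1 - c) * g 4 ^ (n - d) := by
  have hs : seg n = Ico 1 (n + 1) := rfl
  have step : ∀ (k l : ℕ) (x : R), k < l → f k = 1 → (∀ p, k < p → p < l → f p = x) →
      ∏ p ∈ Ico k l, f p = x ^ (l - 1 - k) := by
    intro k l x hkl hk hx
    rw [prod_eq_prod_Ico_succ_bot hkl, hk, one_mul, prod_eq_pow_card (b := x), Nat.card_Ico]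
    · congr 1
      omega
    · intro p hp
      rw [mem_Ico] at hp
      exact hx p (by omega) hp.2
  rw [hs, ← prod_Ico_consecutive f (show 1 ≤ d by omega) (show d ≤ n + 1 by omega),
    ← prod_Ico_consecutive f (show 1 ≤ c by omega) hcd.le,
    ← prod_Ico_consecutive f (show 1 ≤ b by omega) hbc.le,
    ← prod_Ico_consecutive f ha hab.le,
    step a b (g 1) hab, step b c (g 2) hbc, step c d (g 3) hcd, step d (n + 1) (g 4) (by omega),
    prod_eq_pow_card (b := g 0), Nat.card_Ico, Nat.add_sub_cancel]
  · intro p hp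
    rw [mem_Ico] at hp
    rw [h, if_neg (by omega), if_pos (by omega)]
  all_goals first
    | (rw [h, if_pos (by tauto)])
    | (intro p h1 h2
       rw [h]
       split_ifs <;> first | rfl | omega)

/-- The number of pairs of blocks crossing at a given quadruple, weighted by the number of
completions to a set partition. -/
theorem sum_blocks_crossing {n a b c d : ℕ} (ha : 1 ≤ a) (hab : a < b) (hbc : b < c)
    (hcd : c < d) (hd : d ≤ n) :
    (∑ A ∈ (seg n).powerset, ∑ D ∈ (seg n \ A).powerset,
      (if IsBlockEdge A a c ∧ IsBlockEdge D b d then (1 : ℚ) else 0) *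
        Nat.bell ((seg n \ A) \ D).card) =
    umbral (∑ k : Fin 3, ∑ l : Fin 3, edgeSign k * edgeSign l *
      ((outsideValue k + (outsideValue l + Polynomial.X)) ^ (a - 1) *
        (insideValue k + (outsideValue l + Polynomial.X)) ^ (b - 1 - a) *
        (insideValue k + (insideValue l + Polynomial.X)) ^ (c - 1 - b) *
        (outsideValue k + (insideValue l + Polynomial.X)) ^ (d - 1 - c) *
        (outsideValue k + (outsideValue l + Polynomial.X)) ^ (n - d))) := by
  have hmem : ∀ p, 1 ≤ p → p ≤ n → p ∈ seg n := fun p h h' => mem_Icc.2 ⟨h, h'⟩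
  have hgap : ∀ k l : Fin 3,
      (outsideValue k + (outsideValue l + Polynomial.X)) ^ (a - 1) *
        (insideValue k + (outsideValue l + Polynomial.X)) ^ (b - 1 - a) *
        (insideValue k + (insideValue l + Polynomial.X)) ^ (c - 1 - b) *
        (outsideValue k + (insideValue l + Polynomial.X)) ^ (d - 1 - c) *
        (outsideValue k + (outsideValue l + Polynomial.X)) ^ (n - d) =
      ∑ A ∈ (seg n).powerset, ∑ D ∈ (seg n \ A).powerset,
        (if (a ∈ A ∧ c ∈ A) ∧ b ∈ D ∧ d ∈ D then
          (∏ p ∈ A, edgeWeight (insideValue k) (outsideValue k) a c p) *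
          (∏ p ∈ D, edgeWeight (insideValue l) (outsideValue l) b d p) *
            Polynomial.X ^ ((seg n \ A) \ D).card else 0) := by
    intro k l
    rw [sum_pair_weight hab hbc hcd (hmem a (by omega) (by omega)) (hmem b (by omega) (by omega))
      (hmem c (by omega) (by omega)) (hmem d (by omega) (by omega)),
      prod_seg_of_gaps ha hab hbc hcd hd _
        ![outsideValue k + (outsideValue l + Polynomial.X),
          insideValue k + (outsideValue l + Polynomial.X),
          insideValue k + (insideValue l + Polynomial.X),
          outsideValue k + (insideValue l + Polynomial.X),
          outsideValue k + (outsideValue l + Polynomial.X)]]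
    · simp
    · intro p
      simp only [edgeWeight, Matrix.cons_val]
      split_ifs <;> first | rfl | omega
  simp only [hgap, mul_sum]
  rw [sum_congr rfl fun k _ => sum_comm, sum_comm, map_sum]
  refine sum_congr rfl fun A _ => ?_
  rw [sum_congr rfl fun k _ => sum_comm, sum_comm, map_sum]
  refine sum_congr rfl fun D _ => ?_
  by_cases hm : (a ∈ A ∧ c ∈ A) ∧ b ∈ D ∧ d ∈ D
  · simp only [if_pos hm]
    have h : ∀ k l : Fin 3, edgeSign k * edgeSign l *
        ((∏ p ∈ A, edgeWeight (insideValue k) (outsideValue k) a c p) *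
          (∏ p ∈ D, edgeWeight (insideValue l) (outsideValue l) b d p) *
            Polynomial.X ^ ((seg n \ A) \ D).card) =
        ((edgeSign k * ∏ p ∈ A, edgeWeight (insideValue k) (outsideValue k) a c p) *
          (edgeSign l * ∏ p ∈ D, edgeWeight (insideValue l) (outsideValue l) b d p)) *
            Polynomial.X ^ ((seg n \ A) \ D).card := fun k l => by ring
    simp only [h, ← sum_mul, ← mul_sum]
    rw [← isBlockEdge_indicator (hab.trans hbc) hm.1.1 hm.1.2,
      ← isBlockEdge_indicator (hbc.trans hcd) hm.2.1 hm.2.2]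
    by_cases h1 : IsBlockEdge A a c <;> by_cases h2 : IsBlockEdge D b d <;>
      simp [h1, h2, umbral_X_pow]
  · simp only [if_neg hm, mul_zero, sum_const_zero, map_zero]
    rw [if_neg, zero_mul]
    exact fun h => hm ⟨⟨h.1.1, h.1.2.1⟩, h.2.1, h.2.2.1⟩

theorem sum_quads {R : Type*} [AddCommMonoid R] (n : ℕ) (F : ℕ → ℕ → ℕ → ℕ → R) :
    ∑ e ∈ quads n, F e.1.1 e.2.1 e.1.2 e.2.2 =
      ∑ d ∈ range n, ∑ c ∈ range d, ∑ b ∈ range c, ∑ a ∈ range b,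
        F (a + 1) (b + 1) (c + 1) (d + 1) := by
  simp only [sum_sigma']
  refine sum_bij'
    (fun e _ => ⟨e.2.2 - 1, e.1.2 - 1, e.2.1 - 1, e.1.1 - 1⟩)
    (fun s _ => ((s.2.2.2 + 1, s.2.1 + 1), s.2.2.1 + 1, s.1 + 1)) ?_ ?_ ?_ ?_ ?_
  · intro e he
    rw [mem_quads] at he
    simp only [mem_sigma, mem_range]
    omega
  · intro s hs
    simp only [mem_sigma, mem_range] at hs
    simp only [mem_quads]
    omega
  · rintro ⟨⟨a, c⟩, b, d⟩ he
    simp only [mem_quads] at he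
    simp only [Prod.mk.injEq]
    omega
  · intro s _
    simp
  · rintro ⟨⟨a, c⟩, b, d⟩ he
    simp only [mem_quads] at he
    simp only
    congr 1 <;> omega

section Series

open PowerSeries

variable {R : Type*} [CommRing R]

/-- The geometric series with ratio `x`. -/
def geom (x : R) : PowerSeries R := PowerSeries.mk fun k => x ^ k

theorem sum_range_mul_pow (f : PowerSeries R) (x : R) (m : ℕ) :
    ∑ k ∈ range m, coeff k f * x ^ (m - 1 - k) = coeff m (X * f * geom x) := by
  rw [mul_assoc]
  cases m with
  | zero => simp
  | succ m =>
    rw [coeff_succ_X_mul, coeff_mul, Nat.sum_antidiagonal_eq_sum_range_succ_mk]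
    simp [geom]

theorem sum_quads_gaps (n : ℕ) (x₀ x₁ x₂ x₃ x₄ : R) :
    ∑ e ∈ quads n, x₀ ^ (e.1.1 - 1) * x₁ ^ (e.2.1 - 1 - e.1.1) * x₂ ^ (e.1.2 - 1 - e.2.1) *
      x₃ ^ (e.2.2 - 1 - e.1.2) * x₄ ^ (n - e.2.2) =
    coeff n (X ^ 4 * (geom x₀ * geom x₁ * geom x₂ * geom x₃ * geom x₄)) := by
  rw [sum_quads n fun a b c d => x₀ ^ (a - 1) * x₁ ^ (b - 1 - a) * x₂ ^ (c - 1 - b) *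
      x₃ ^ (d - 1 - c) * x₄ ^ (n - d)]
  have h (a b c d : ℕ) : x₀ ^ (a + 1 - 1) * x₁ ^ (b + 1 - 1 - (a + 1)) *
      x₂ ^ (c + 1 - 1 - (b + 1)) * x₃ ^ (d + 1 - 1 - (c + 1)) * x₄ ^ (n - (d + 1)) =
      coeff a (geom x₀) * x₁ ^ (b - 1 - a) * x₂ ^ (c - 1 - b) * x₃ ^ (d - 1 - c) *
        x₄ ^ (n - 1 - d) := by
    have e (k l : ℕ) : l - (k + 1) = l - 1 - k := by omega
    rw [geom, coeff_mk, e a, e b, e c, e d, Nat.add_sub_cancel, Nat.add_sub_cancel,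
      Nat.add_sub_cancel, Nat.add_sub_cancel]
  simp only [h, ← sum_mul, sum_range_mul_pow]
  congr 1
  ring

theorem geom_sub (x y : R) :
    geom y - geom x = C (y - x) * (X * geom x * geom y) := by
  have h (z : R) : geom z * (1 - C z * X) = 1 := by
    ext k
    cases k with
    | zero => simp [geom]
    | succ k =>
      rw [mul_sub, mul_one, map_sub, mul_comm (C z), ← mul_assoc, coeff_mul_C,
        coeff_succ_mul_X]
      simp [geom, pow_succ, coeff_one]
  rw [map_sub]
  linear_combination geom x * h y - geom y * h x

theorem coeff_geom_pow (x : R) (d k : ℕ) :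
    coeff k (geom x ^ (d + 1)) = (d + k).choose d * x ^ k := by
  have h : geom x = rescale x (mk 1) := by
    ext k
    simp [geom]
  rw [h, ← map_pow, mk_one_pow_eq_mk_choose_add, coeff_rescale, coeff_mk, mul_comm]

/-- Partial fraction decomposition of the generating series of circular crossings. -/
theorem series_identity (x : R) {P Q S : PowerSeries R} (hP : P = geom x)
    (hQ : Q = geom (x + 1)) (hS : S = geom (x + 2)) :
    2 * (X ^ 4 * (P * Q ^ 2 * S * (S + 2 * Q + P) - 2 * (P ^ 2 * Q ^ 2 * (Q + P)) + P ^ 5)) =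
      X * (S ^ 2 - P ^ 2) - 4 * (X ^ 2 * Q ^ 3) - 4 * (X ^ 2 * (Q ^ 3 + P ^ 3)) +
        4 * (X * (Q ^ 2 - P ^ 2)) + 2 * (X ^ 4 * P ^ 5) := by
  have h1 : Q - P = X * P * Q := by
    rw [hP, hQ, geom_sub, add_sub_cancel_left, map_one, one_mul]
  have h2 : S - Q = X * Q * S := by
    rw [hQ, hS, geom_sub, show x + 2 - (x + 1) = 1 by ring, map_one, one_mul]
  have h3 : S - P = 2 * (X * P * S) := by
    rw [hP, hS, geom_sub, add_sub_cancel_left, map_ofNat]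
  clear hP hQ hS
  have e1 : 2 * (X ^ 2 * P * Q * S) = S - 2 * Q + P := by
    linear_combination (-2 * X * S) * h1 - 2 * h2 + h3
  have e2 : 2 * (X ^ 3 * P * Q ^ 2 * S) = S - P - 2 * X * Q ^ 2 := by
    linear_combination X * Q * e1 - h2 - h1
  have e3 : X ^ 4 * (P ^ 2 * Q ^ 2 * (Q + P)) = X ^ 2 * (Q ^ 3 + P ^ 3) - X * (Q ^ 2 - P ^ 2) := by
    have : X ^ 4 * (P ^ 2 * Q ^ 2 * (Q + P)) = X ^ 2 * (X * P * Q) ^ 2 * (Q + P) := by ring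
    rw [this, ← h1]
    linear_combination X * (Q + P) * h1
  have e4 : 2 * (X ^ 4 * (P * Q ^ 2 * S * (S + 2 * Q + P))) =
      X * (S ^ 2 - P ^ 2) - 4 * (X ^ 2 * Q ^ 3) := by
    linear_combination X * (S + 2 * Q + P) * e2 + 2 * X * Q * (h1 + h2)
  linear_combination e4 - 4 * e3

theorem coeff_natCast_mul (n k : ℕ) (f : PowerSeries R) :
    coeff n ((k : PowerSeries R) * f) = k * coeff n f := by
  rw [← nsmul_eq_mul, map_nsmul, nsmul_eq_mul]

theorem coeff_geom_sq (x : R) (m : ℕ) :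
    coeff (m + 3) (geom x ^ 2) = (m + 4) * x ^ (m + 3) := by
  rw [coeff_geom_pow x 1, Nat.choose_one_right]
  push_cast
  ring

theorem two_mul_coeff_geom_cube (x : R) (m : ℕ) :
    2 * coeff (m + 2) (geom x ^ 3) = (m + 4) * (m + 3) * x ^ (m + 2) := by
  have h : ((m + 4 : ℕ) * (m + 3 : ℕ) : R) = ((m + 4).choose 2 * 2 : ℕ) := by
    rw [← Nat.cast_mul]
    congr 1
    simpa using Nat.add_one_mul_choose_eq (m + 3) 1
  push_cast at h
  rw [coeff_geom_pow x 2, show 2 + (m + 2) = m + 4 by omega, h]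
  ring

theorem two_mul_coeff_series (x : R) (m : ℕ) {P Q S : PowerSeries R} (hP : P = geom x)
    (hQ : Q = geom (x + 1)) (hS : S = geom (x + 2)) :
    2 * (coeff (m + 4) (X ^ 4 * (S * Q * P * Q * S)) + coeff (m + 4) (X ^ 4 * (Q * P * Q * S * Q)) -
      coeff (m + 4) (X ^ 4 * (Q * P * P * Q * Q)) + coeff (m + 4) (X ^ 4 * (Q * S * Q * P * Q)) +
      coeff (m + 4) (X ^ 4 * (P * Q * S * Q * P)) - coeff (m + 4) (X ^ 4 * (P * Q * Q * P * P)) -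
      coeff (m + 4) (X ^ 4 * (Q * Q * P * P * Q)) - coeff (m + 4) (X ^ 4 * (P * P * Q * Q * P)) +
      coeff (m + 4) (X ^ 4 * (P * P * P * P * P))) =
    (m + 4) * ((x + 2) ^ (m + 3) - x ^ (m + 3)) - 2 * (m + 4) * (m + 3) * (x + 1) ^ (m + 2) -
      2 * (m + 4) * (m + 3) * ((x + 1) ^ (m + 2) + x ^ (m + 2)) +
      4 * (m + 4) * ((x + 1) ^ (m + 3) - x ^ (m + 3)) + 2 * (m + 4).choose 4 * x ^ m := by
  have key := congrArg (coeff (m + 4)) (series_identity x hP hQ hS)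
  have hF : X ^ 4 * (P * Q ^ 2 * S * (S + 2 * Q + P) - 2 * (P ^ 2 * Q ^ 2 * (Q + P)) + P ^ 5) =
      X ^ 4 * (S * Q * P * Q * S) + X ^ 4 * (Q * P * Q * S * Q) - X ^ 4 * (Q * P * P * Q * Q) +
      X ^ 4 * (Q * S * Q * P * Q) + X ^ 4 * (P * Q * S * Q * P) - X ^ 4 * (P * Q * Q * P * P) -
      X ^ 4 * (Q * Q * P * P * Q) - X ^ 4 * (P * P * Q * Q * P) + X ^ 4 * (P * P * P * P * P) := by
    ring
  have h1 (f : PowerSeries R) : coeff (m + 4) (X * f) = coeff (m + 3) f := by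
    rw [← coeff_succ_X_mul (m + 3) f]
  have h2 (f : PowerSeries R) : coeff (m + 4) (X ^ 2 * f) = coeff (m + 2) f := by
    rw [← coeff_X_pow_mul f 2 (m + 2)]
  have h4 (f : PowerSeries R) : coeff (m + 4) (X ^ 4 * f) = coeff m f := by
    rw [← coeff_X_pow_mul f 4 m]
  have h5 : coeff m (P ^ 5) = (m + 4).choose 4 * x ^ m := by
    rw [hP, coeff_geom_pow x 4, add_comm 4 m]
  have c2 (f : PowerSeries R) : coeff (m + 4) (2 * f) = 2 * coeff (m + 4) f := by
    exact_mod_cast coeff_natCast_mul (m + 4) 2 f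
  have c4 (f : PowerSeries R) : coeff (m + 4) (4 * f) = 4 * coeff (m + 4) f := by
    exact_mod_cast coeff_natCast_mul (m + 4) 4 f
  rw [hF, c2] at key
  simp only [map_add, map_sub] at key ⊢
  rw [key, c2, c4, c4, c4, h1, h1, h2, h2, h4, h5, map_sub, map_sub, map_add, hP, hQ, hS,
    coeff_geom_sq, coeff_geom_sq, coeff_geom_sq]
  linear_combination (-4 : R) * two_mul_coeff_geom_cube (x + 1) m -
    2 * two_mul_coeff_geom_cube x m

end Series

theorem two_mul_sum_croc (m : ℕ) :
    2 * ∑ P ∈ partitions (m + 4), (croc P : ℚ) =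
      umbral ((m + 4 : ℚ) • ((Polynomial.X + 2) ^ (m + 3) - Polynomial.X ^ (m + 3)) -
        (2 * (m + 4) * (m + 3) : ℚ) • (Polynomial.X + 1) ^ (m + 2) -
        (2 * (m + 4) * (m + 3) : ℚ) • ((Polynomial.X + 1) ^ (m + 2) + Polynomial.X ^ (m + 2)) +
        (4 * (m + 4) : ℚ) • ((Polynomial.X + 1) ^ (m + 3) - Polynomial.X ^ (m + 3)) +
        (2 * (m + 4).choose 4 : ℚ) • Polynomial.X ^ m) := by
  have h : ∀ e ∈ quads (m + 4), _ = _ := fun e he =>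
    sum_blocks_crossing (mem_quads.1 he).1 (mem_quads.1 he).2.1 (mem_quads.1 he).2.2.1
      (mem_quads.1 he).2.2.2.1 (mem_quads.1 he).2.2.2.2
  rw [sum_croc, sum_congr rfl h, ← map_sum, sum_comm, sum_congr rfl fun k _ => sum_comm]
  simp only [← mul_sum, sum_quads_gaps]
  rw [← smul_eq_mul, ← map_smul]
  congr 1
  have hQ : geom (1 + Polynomial.X : Polynomial ℚ) = geom (Polynomial.X + 1) := by rw [add_comm]
  have hS : geom (1 + (1 + Polynomial.X) : Polynomial ℚ) = geom (Polynomial.X + 2) := by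
    congr 1
    ring
  simp only [Fin.sum_univ_three, edgeSign, insideValue, outsideValue, Matrix.cons_val, zero_add,
    hQ, hS, Polynomial.smul_eq_C_mul, map_mul, map_add, map_ofNat, map_natCast]
  rw [← two_mul_coeff_series Polynomial.X m rfl rfl rfl]
  ring

end CircularCrossings

/-- exact total and average number of circular crossings over `Π_n`. -/
theorem croc_mean_over_partitions (n : ℕ) (hn : 4 ≤ n) :
    (∑ π ∈ partitions n, (croc π : ℚ))
        = ((n : ℚ)/2) * (bell (n+1) : ℚ) + (3*(n : ℚ)/2) * (bell n : ℚ)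
            - ((n : ℚ) * (4*(n : ℚ) + 1) / 2) * (bell (n-1) : ℚ)
            - (n : ℚ) * ((n : ℚ) - 1) * (bell (n-2) : ℚ)
            + (n.choose 4 : ℚ) * (bell (n-4) : ℚ) ∧
    (∑ π ∈ partitions n, (croc π : ℚ)) / (bell n : ℚ)
        = (((n : ℚ)/2) * (bell (n+1) : ℚ) + (3*(n : ℚ)/2) * (bell n : ℚ)
            - ((n : ℚ) * (4*(n : ℚ) + 1) / 2) * (bell (n-1) : ℚ)
            - (n : ℚ) * ((n : ℚ) - 1) * (bell (n-2) : ℚ)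
            + (n.choose 4 : ℚ) * (bell (n-4) : ℚ)) / (bell n : ℚ) := by
  refine and_iff_left_of_imp (fun h => by rw [h]) |>.2 ?_
  obtain ⟨m, rfl⟩ := Nat.exists_eq_add_of_le' hn
  have h := CircularCrossings.two_mul_sum_croc m
  simp only [map_add, map_sub, map_smul, smul_eq_mul, CircularCrossings.umbral_X_pow,
    CircularCrossings.umbral_X_add_one_pow, CircularCrossings.umbral_X_add_two_pow] at h
  simp only [CircularCrossings.bell_eq, Nat.add_sub_cancel, show m + 4 - 1 = m + 3 by omega,
    show m + 4 - 2 = m + 2 by omega]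
  push_cast
  linear_combination h / 2
end

section
/- For all integers n ≥ 4 and k ≥ 2 one has the identity (in ℚ): Σ_{π ∈ Π_n^k} croc(π) = (n(k−1)/2)·S_{n,k} + (n/2)·(5k − 4n − 1)·S_{n−1,k−1} − n(n−1)·S_{n−2,k−2} + C(n,4)·S_{n−4,k−2}, where C(n,4) is a binomial coefficient. Equivalently, the average number of circular crossings in a random set partition of [n] into k blocks equals this quantity divided by S_{n,k}. -/
open scoped Classical

/-- The partitions of `S` into `k` blocks. -/
noncomputable def partitionsOf (S : Finset ℕ) (k : ℕ) : Finset (Finset (Finset ℕ)) :=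
  S.powerset.powerset.filter fun P => IsPartition P S ∧ P.card = k

theorem mem_partitionsOf {S : Finset ℕ} {k : ℕ} {P : Finset (Finset ℕ)} :
    P ∈ partitionsOf S k ↔ IsPartition P S ∧ P.card = k := by
  simp only [partitionsOf, Finset.mem_filter, Finset.mem_powerset, and_iff_right_iff_imp]
  rintro ⟨⟨-, -, h⟩, -⟩ B hB
  rw [Finset.mem_powerset, ← h]
  exact Finset.subset_biUnion_of_mem id hB

theorem partitionsK_eq (n k : ℕ) : partitionsK n k = partitionsOf (seg n) k := by
  ext P
  simp [partitionsK, partitions, partitionsOf, and_assoc]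

theorem IsPartition.erase {P : Finset (Finset ℕ)} {S A : Finset ℕ} (h : IsPartition P S)
    (hA : A ∈ P) : IsPartition (P.erase A) (S \ A) := by
  obtain ⟨h0, hd, hu⟩ := h
  refine ⟨fun h => h0 (Finset.mem_of_mem_erase h), fun B hB C hC => hd B
    (Finset.mem_of_mem_erase hB) C (Finset.mem_of_mem_erase hC), ?_⟩
  subst hu
  ext x
  simp only [Finset.mem_biUnion, Finset.mem_erase, id, Finset.mem_sdiff]
  constructor
  · rintro ⟨B, ⟨hBA, hB⟩, hx⟩
    exact ⟨⟨B, hB, hx⟩, Finset.disjoint_left.1 (hd B hB A hA hBA) hx⟩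
  · rintro ⟨⟨B, hB, hx⟩, hxA⟩
    exact ⟨B, ⟨fun h => hxA (h ▸ hx), hB⟩, hx⟩

theorem IsPartition.subset {P : Finset (Finset ℕ)} {S A : Finset ℕ} (h : IsPartition P S)
    (hA : A ∈ P) : A ⊆ S := by
  rw [← h.2.2]
  exact Finset.subset_biUnion_of_mem id hA

theorem IsPartition.nonempty {P : Finset (Finset ℕ)} {S A : Finset ℕ} (h : IsPartition P S)
    (hA : A ∈ P) : A.Nonempty :=
  Finset.nonempty_iff_ne_empty.2 fun h0 => h.1 (h0 ▸ hA)

theorem IsPartition.notMem {Q : Finset (Finset ℕ)} {S A : Finset ℕ} (h : IsPartition Q (S \ A))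
    (hA : A.Nonempty) : A ∉ Q := fun hAQ => by
  obtain ⟨x, hx⟩ := hA
  exact (Finset.mem_sdiff.1 (h.subset hAQ hx)).2 hx

theorem IsPartition.insert {Q : Finset (Finset ℕ)} {S A : Finset ℕ} (h : IsPartition Q (S \ A))
    (hA : A.Nonempty) (hAS : A ⊆ S) : IsPartition (insert A Q) S := by
  have hdis : ∀ B ∈ Q, Disjoint A B := fun B hB =>
    (Finset.sdiff_disjoint.mono_left (h.subset hB)).symm
  refine ⟨?_, ?_, ?_⟩
  · rw [Finset.mem_insert, not_or]
    exact ⟨hA.ne_empty.symm, h.1⟩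
  · intro B hB C hC hBC
    rcases Finset.mem_insert.1 hB with rfl | hBQ <;> rcases Finset.mem_insert.1 hC with rfl | hCQ
    · exact absurd rfl hBC
    · exact hdis C hCQ
    · exact (hdis B hBQ).symm
    · exact h.2.1 B hBQ C hCQ hBC
  · rw [Finset.biUnion_insert, h.2.2, id, Finset.union_sdiff_of_subset hAS]

/-- Pointing at a block of a partition amounts to choosing that block and
partitioning its complement. -/
theorem sum_partitionsOf_erase (S : Finset ℕ) (k : ℕ)
    (F : Finset ℕ → Finset (Finset ℕ) → ℕ) :
    ∑ P ∈ partitionsOf S (k + 1), ∑ A ∈ P, F A (P.erase A) =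
      ∑ A ∈ S.powerset with A.Nonempty, ∑ Q ∈ partitionsOf (S \ A) k, F A Q := by
  rw [Finset.sum_sigma', Finset.sum_sigma']
  refine Finset.sum_bij' (fun x _ => ⟨x.2, x.1.erase x.2⟩) (fun x _ => ⟨insert x.1 x.2, x.1⟩)
    ?_ ?_ ?_ ?_ ?_
  · rintro ⟨P, A⟩ h
    simp only [Finset.mem_sigma, mem_partitionsOf, Finset.mem_filter, Finset.mem_powerset] at h ⊢
    exact ⟨⟨h.1.1.subset h.2, h.1.1.nonempty h.2⟩, h.1.1.erase h.2, by
      rw [Finset.card_erase_of_mem h.2, h.1.2, Nat.add_sub_cancel]⟩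
  · rintro ⟨A, Q⟩ h
    simp only [Finset.mem_sigma, mem_partitionsOf, Finset.mem_filter, Finset.mem_powerset] at h ⊢
    exact ⟨⟨h.2.1.insert h.1.2 h.1.1, by
      rw [Finset.card_insert_of_notMem (h.2.1.notMem h.1.2), h.2.2]⟩, Finset.mem_insert_self _ _⟩
  · rintro ⟨P, A⟩ h
    simp only [Finset.mem_sigma] at h
    simp only [Finset.insert_erase h.2]
  · rintro ⟨A, Q⟩ h
    simp only [Finset.mem_sigma, mem_partitionsOf, Finset.mem_filter] at h
    simp only [Finset.erase_insert (h.2.1.notMem h.1.2)]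
  · simp

/-- The convolution of Stirling numbers with a weight on the size of a distinguished subset. -/
def stirlingConv (n j : ℕ) (h : ℕ → ℚ) : ℚ :=
  ∑ m ∈ Finset.range (n + 1), (n.choose m : ℚ) * (n - m).stirlingSecond j * h m

theorem stirlingConv_zero_left (j : ℕ) (h : ℕ → ℚ) :
    stirlingConv 0 j h = Nat.stirlingSecond 0 j * h 0 := by
  simp [stirlingConv]

theorem stirlingConv_succ (n j : ℕ) (h : ℕ → ℚ) :
    stirlingConv (n + 1) j h = stirlingConv n j (fun m => h (m + 1)) +
      ∑ m ∈ Finset.range (n + 1), (n.choose m : ℚ) * (n + 1 - m).stirlingSecond j * h m := by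
  unfold stirlingConv
  rw [Finset.sum_range_succ', Finset.sum_range_succ' (fun m => (n.choose m : ℚ) * _ * h m)]
  have h0 : ∑ x ∈ Finset.range (n + 1), (n.choose (x + 1) : ℚ) *
      (n + 1 - (x + 1)).stirlingSecond j * h (x + 1) =
      ∑ x ∈ Finset.range n, (n.choose (x + 1) : ℚ) *
      (n + 1 - (x + 1)).stirlingSecond j * h (x + 1) := by
    rw [Finset.sum_range_succ]
    simp
  rw [← h0]
  simp only [Nat.choose_succ_succ, Nat.cast_add, add_mul, Finset.sum_add_distrib,
    Nat.add_sub_add_right, Nat.choose_zero_right, Nat.sub_zero]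
  ring

theorem sum_choose_mul_stirlingSecond_succ (n j : ℕ) (h : ℕ → ℚ) :
    ∑ m ∈ Finset.range (n + 1), (n.choose m : ℚ) * (n + 1 - m).stirlingSecond (j + 1) * h m =
      (j + 1) * stirlingConv n (j + 1) h + stirlingConv n j h := by
  unfold stirlingConv
  rw [Finset.mul_sum, ← Finset.sum_add_distrib]
  refine Finset.sum_congr rfl fun m hm => ?_
  rw [Nat.sub_add_comm (Finset.mem_range_succ_iff.1 hm), Nat.stirlingSecond_succ_succ]
  push_cast
  ring

theorem stirlingConv_succ_succ (n j : ℕ) (h : ℕ → ℚ) :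
    stirlingConv (n + 1) (j + 1) h = stirlingConv n (j + 1) (fun m => h (m + 1)) +
      ((j + 1) * stirlingConv n (j + 1) h + stirlingConv n j h) := by
  rw [stirlingConv_succ, sum_choose_mul_stirlingSecond_succ]

theorem stirlingConv_succ_zero (n : ℕ) (h : ℕ → ℚ) :
    stirlingConv (n + 1) 0 h = stirlingConv n 0 (fun m => h (m + 1)) := by
  rw [stirlingConv_succ, add_eq_left]
  refine Finset.sum_eq_zero fun m hm => ?_
  rw [Nat.sub_add_comm (Finset.mem_range_succ_iff.1 hm)]
  simp

theorem stirlingConv_const_mul (n j : ℕ) (c : ℚ) (h : ℕ → ℚ) :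
    stirlingConv n j (fun m => c * h m) = c * stirlingConv n j h := by
  unfold stirlingConv
  rw [Finset.mul_sum]
  exact Finset.sum_congr rfl fun m _ => by ring

theorem stirlingConv_add (n j : ℕ) (g h : ℕ → ℚ) :
    stirlingConv n j (fun m => g m + h m) = stirlingConv n j g + stirlingConv n j h := by
  unfold stirlingConv
  rw [← Finset.sum_add_distrib]
  exact Finset.sum_congr rfl fun m _ => by ring

theorem stirlingConv_one (n j : ℕ) :
    stirlingConv n j (fun _ => 1) = (n + 1).stirlingSecond (j + 1) := by
  induction n generalizing j with
  | zero => cases j <;> simp [stirlingConv_zero_left, Nat.stirlingSecond_succ_succ]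
  | succ n ih =>
    cases j with
    | zero => rw [stirlingConv_succ_zero, ih, Nat.stirlingSecond_one_right,
        Nat.stirlingSecond_one_right]
    | succ j =>
      rw [stirlingConv_succ_succ, ih, ih, Nat.stirlingSecond_succ_succ (n + 1)]
      push_cast
      ring

theorem stirlingConv_two_pow (n j : ℕ) :
    stirlingConv n j (fun m => 2 ^ m) =
      (j + 1) * (n + 1).stirlingSecond (j + 2) + (n + 1).stirlingSecond (j + 1) := by
  induction n generalizing j with
  | zero => cases j <;> simp [stirlingConv_zero_left, Nat.stirlingSecond_succ_succ]
  | succ n ih =>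
    cases j with
    | zero =>
      simp only [pow_succ', stirlingConv_succ_zero, stirlingConv_const_mul, ih,
        Nat.stirlingSecond_succ_succ (n + 1)]
      simp
      ring
    | succ j =>
      simp only [pow_succ', stirlingConv_succ_succ, stirlingConv_const_mul, ih,
        Nat.stirlingSecond_succ_succ (n + 1)]
      push_cast
      ring

theorem stirlingConv_id_mul (n j : ℕ) (h : ℕ → ℚ) :
    stirlingConv (n + 1) j (fun m => m * h m) =
      (n + 1) * stirlingConv n j (fun m => h (m + 1)) := by
  unfold stirlingConv
  rw [Finset.sum_range_succ', Finset.mul_sum]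
  simp only [Nat.cast_zero, zero_mul, mul_zero, add_zero, Nat.add_sub_add_right]
  refine Finset.sum_congr rfl fun m _ => ?_
  have := congrArg (Nat.cast : ℕ → ℚ) (Nat.add_one_mul_choose_eq n m)
  push_cast at this ⊢
  linear_combination (-(((n - m).stirlingSecond j : ℕ) : ℚ) * h (m + 1)) * this

theorem stirlingConv_single {n a : ℕ} (j : ℕ) (ha : a ≤ n) :
    stirlingConv n j (fun m => if m = a then 1 else 0) =
      n.choose a * (n - a).stirlingSecond j := by
  simp [stirlingConv, ha]

theorem card_partitionsOf (S : Finset ℕ) (k : ℕ) :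
    (partitionsOf S k).card = S.card.stirlingSecond k := by
  induction S using Finset.strongInduction generalizing k with
  | H S ih =>
    rcases k with _ | k
    · rcases S.eq_empty_or_nonempty with rfl | hS
      · have : partitionsOf ∅ 0 = {∅} := by
          ext P
          simp only [mem_partitionsOf, Finset.card_eq_zero, Finset.mem_singleton,
            and_iff_right_iff_imp]
          rintro rfl
          simp [IsPartition]
        simp [this]
      · obtain ⟨m, hm⟩ := Nat.exists_eq_succ_of_ne_zero hS.card_pos.ne'
        rw [hm, Nat.stirlingSecond_succ_zero, Finset.card_eq_zero,
          Finset.eq_empty_iff_forall_notMem]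
        intro P hP
        rw [mem_partitionsOf, Finset.card_eq_zero] at hP
        obtain ⟨⟨-, -, hu⟩, rfl⟩ := hP
        exact hS.ne_empty (by simpa using hu.symm)
    · rcases S.eq_empty_or_nonempty with rfl | ⟨a, ha⟩
      · rw [Finset.card_empty, Nat.stirlingSecond_zero_succ, Finset.card_eq_zero,
          Finset.eq_empty_iff_forall_notMem]
        intro P hP
        rw [mem_partitionsOf] at hP
        obtain ⟨A, hA⟩ := Finset.card_pos.1 (by rw [hP.2]; exact k.succ_pos)
        exact (hP.1.nonempty hA).ne_empty (Finset.subset_empty.1 (hP.1.subset hA))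
      · have key := sum_partitionsOf_erase S k (fun A _ => if a ∈ A then 1 else 0)
        have h1 : ∀ P ∈ partitionsOf S (k + 1), (∑ A ∈ P, if a ∈ A then 1 else 0) = 1 := by
          intro P hP
          rw [mem_partitionsOf] at hP
          have haP := ha
          rw [← hP.1.2.2, Finset.mem_biUnion] at haP
          obtain ⟨A, hA, haA : a ∈ A⟩ := haP
          rw [Finset.sum_eq_single_of_mem A hA, if_pos haA]
          intro B hB hBA
          exact if_neg fun haB =>
            Finset.disjoint_left.1 (hP.1.2.1 B hB A hA hBA) haB haA
        rw [Finset.sum_congr rfl h1, Finset.sum_const, smul_eq_mul, mul_one] at key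
        rw [key]
        obtain ⟨T, haT, rfl⟩ : ∃ T, a ∉ T ∧ insert a T = S :=
          ⟨S.erase a, Finset.notMem_erase a S, Finset.insert_erase ha⟩
        have h2 : ∑ A ∈ (insert a T).powerset with A.Nonempty,
            ∑ Q ∈ partitionsOf (insert a T \ A) k, (if a ∈ A then 1 else 0) =
            ∑ B ∈ T.powerset, (T.card - B.card).stirlingSecond k := by
          rw [Finset.sum_filter, Finset.sum_powerset_insert haT]
          have hz : ∑ B ∈ T.powerset, (if B.Nonempty then
              ∑ Q ∈ partitionsOf (insert a T \ B) k, (if a ∈ B then 1 else 0) else 0) = 0 := by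
            refine Finset.sum_eq_zero fun B hB => ?_
            have : a ∉ B := fun h => haT (Finset.mem_powerset.1 hB h)
            simp [this]
          rw [hz, zero_add]
          refine Finset.sum_congr rfl fun B hB => ?_
          have hBT := Finset.mem_powerset.1 hB
          have hs : insert a T \ insert a B = T \ B := by
            rw [Finset.insert_sdiff_insert, Finset.sdiff_insert_of_notMem haT]
          simp only [Finset.insert_nonempty, if_true, Finset.mem_insert_self, Finset.sum_const,
            smul_eq_mul, mul_one]
          rw [hs, ih _ (Finset.sdiff_subset.trans_ssubset (Finset.ssubset_insert haT)),
            Finset.card_sdiff_of_subset hBT]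
        rw [h2, Finset.sum_powerset_apply_card (fun m => (T.card - m).stirlingSecond k),
          Finset.card_insert_of_notMem haT]
        have := stirlingConv_one T.card k
        simp only [stirlingConv, mul_one] at this
        simp only [smul_eq_mul]
        exact_mod_cast this

theorem stirling_eq (n k : ℕ) : stirling n k = n.stirlingSecond k := by
  rw [stirling, partitionsK_eq, card_partitionsOf, seg, Nat.card_Icc, Nat.add_sub_cancel]

/-- Given two elements `i < j` of `A`, the chord from `i` to `j` is a side of the polygon
with vertex set `A`. -/
def IsSide {α : Type*} [LinearOrder α] (A : Finset α) (i j : α) : Prop :=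
  (∀ p ∈ A, ¬(i < p ∧ p < j)) ∨ ∀ p ∈ A, i ≤ p ∧ p ≤ j

theorem isCircEdge_iff {P : Finset (Finset ℕ)} {i j : ℕ} :
    IsCircEdge P i j ↔ ∃ A ∈ P, (i ∈ A ∧ j ∈ A) ∧ i < j ∧ IsSide A i j := by
  constructor
  · rintro (⟨hij, A, hA, hi, hj, h⟩ | ⟨A, hA, hne, hc, rfl, rfl⟩)
    · exact ⟨A, hA, ⟨hi, hj⟩, hij, Or.inl h⟩
    · exact ⟨A, hA, ⟨A.min'_mem hne, A.max'_mem hne⟩, A.min'_lt_max'_of_card hc,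
        Or.inr fun p hp => ⟨A.min'_le p hp, A.le_max' p hp⟩⟩
  · rintro ⟨A, hA, ⟨hi, hj⟩, hij, h | h⟩
    · exact Or.inl ⟨hij, A, hA, hi, hj, h⟩
    · refine Or.inr ⟨A, hA, ⟨i, hi⟩, Finset.one_lt_card.2 ⟨i, hi, j, hj, hij.ne⟩, ?_, ?_⟩
      · exact le_antisymm (Finset.le_min' _ _ _ fun p hp => (h p hp).1) (Finset.min'_le _ _ hi)
      · exact le_antisymm (Finset.le_max' _ _ hj) (Finset.max'_le _ _ _ fun p hp => (h p hp).2)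

/-- The crossings of a side of `A` with a later starting side of `B`. -/
noncomputable def crossings {α : Type*} [LinearOrder α] (A B : Finset α) :
    Finset ((α × α) × α × α) :=
  ((A ×ˢ A) ×ˢ (B ×ˢ B)).filter fun e =>
    (e.1.1 < e.2.1 ∧ e.2.1 < e.1.2 ∧ e.1.2 < e.2.2) ∧
      IsSide A e.1.1 e.1.2 ∧ IsSide B e.2.1 e.2.2

theorem mem_crossings {α : Type*} [LinearOrder α] {A B : Finset α} {e : (α × α) × α × α} :
    e ∈ crossings A B ↔ ((e.1.1 ∈ A ∧ e.1.2 ∈ A) ∧ e.2.1 ∈ B ∧ e.2.2 ∈ B) ∧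
      (e.1.1 < e.2.1 ∧ e.2.1 < e.1.2 ∧ e.1.2 < e.2.2) ∧
      IsSide A e.1.1 e.1.2 ∧ IsSide B e.2.1 e.2.2 := by
  simp only [crossings, Finset.mem_filter, Finset.mem_product]

theorem crossings_empty_left {α : Type*} [LinearOrder α] (B : Finset α) :
    crossings ∅ B = ∅ := by simp [crossings]

theorem crossings_empty_right {α : Type*} [LinearOrder α] (A : Finset α) :
    crossings A ∅ = ∅ := by simp [crossings]

theorem isSide_map {α β : Type*} [LinearOrder α] [LinearOrder β] (f : α ↪o β) (A : Finset α)
    (i j : α) : IsSide (A.map f.toEmbedding) (f i) (f j) ↔ IsSide A i j := by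
  simp [IsSide]

theorem card_crossings_map {α β : Type*} [LinearOrder α] [LinearOrder β] (f : α ↪o β)
    (A B : Finset α) :
    (crossings (A.map f.toEmbedding) (B.map f.toEmbedding)).card = (crossings A B).card := by
  symm
  refine Finset.card_bij (fun e _ => ((f e.1.1, f e.1.2), f e.2.1, f e.2.2)) ?_ ?_ ?_
  · intro e he
    rw [mem_crossings] at he ⊢
    simpa [isSide_map] using he
  · rintro ⟨⟨a, c⟩, b, d⟩ - ⟨⟨a', c'⟩, b', d'⟩ - h
    simpa using h
  · rintro ⟨⟨a, c⟩, b, d⟩ he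
    rw [mem_crossings] at he
    simp only [Finset.mem_map] at he
    obtain ⟨⟨⟨⟨a, ha, rfl⟩, ⟨c, hc, rfl⟩⟩, ⟨b, hb, rfl⟩, ⟨d, hd, rfl⟩⟩, he⟩ := he
    refine ⟨((a, c), b, d), mem_crossings.2 ⟨⟨⟨ha, hc⟩, hb, hd⟩, ?_⟩, rfl⟩
    simpa [isSide_map] using he

theorem croc_eq {P : Finset (Finset ℕ)} {S : Finset ℕ} (hP : IsPartition P S) :
    croc P = ∑ A ∈ P, ∑ B ∈ P.erase A, (crossings A B).card := by
  have huniq : ∀ A ∈ P, ∀ B ∈ P, ∀ x, x ∈ A → x ∈ B → A = B := fun A hA B hB x hxA hxB => by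
    by_contra h
    exact Finset.disjoint_left.1 (hP.2.1 A hA B hB h) hxA hxB
  rw [Finset.sum_sigma']
  rw [← Finset.card_sigma, croc, ← Nat.card_eq_finsetCard]
  symm
  refine Nat.card_eq_of_bijective (fun x => ⟨x.1.2, ?_⟩) ⟨?_, ?_⟩
  · obtain ⟨⟨⟨A, B⟩, e⟩, h⟩ := x
    simp only [Finset.mem_sigma, Finset.mem_erase, mem_crossings] at h
    obtain ⟨⟨hA, -, hB⟩, ⟨h1, h2⟩, h3, h4, h5⟩ := h
    exact ⟨isCircEdge_iff.2 ⟨A, hA, h1, h3.1.trans h3.2.1, h4⟩,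
      isCircEdge_iff.2 ⟨B, hB, h2, h3.2.1.trans h3.2.2, h5⟩, h3⟩
  · rintro ⟨⟨⟨A, B⟩, e⟩, h⟩ ⟨⟨⟨A', B'⟩, e'⟩, h'⟩ hee
    obtain rfl : e = e' := congrArg Subtype.val hee
    simp only [Finset.mem_sigma, Finset.mem_erase, mem_crossings] at h h'
    obtain rfl := huniq A h.1.1 A' h'.1.1 _ h.2.1.1.1 h'.2.1.1.1
    obtain rfl := huniq B h.1.2.2 B' h'.1.2.2 _ h.2.1.2.1 h'.2.1.2.1
    rfl
  · rintro ⟨e, h1, h2, h3⟩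
    obtain ⟨A, hA, hA1, hA2, hA3⟩ := isCircEdge_iff.1 h1
    obtain ⟨B, hB, hB1, hB2, hB3⟩ := isCircEdge_iff.1 h2
    have hBA : B ≠ A := by
      rintro rfl
      rcases hA3 with h | h
      · exact h _ hB1.1 ⟨h3.1, h3.2.1⟩
      · exact absurd (h _ hB1.2).2 (not_le.2 h3.2.2)
    refine ⟨⟨⟨⟨A, B⟩, e⟩, ?_⟩, rfl⟩
    simp only [Finset.mem_sigma, Finset.mem_erase, mem_crossings]
    exact ⟨⟨hA, hBA, hB⟩, ⟨hA1, hB1⟩, h3, hA3, hB3⟩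

/-- The number of crossings between two complementary subsets of `U`, summed over all such
pairs of subsets. -/
noncomputable def crossingSum {α : Type*} [LinearOrder α] (U : Finset α) : ℕ :=
  ∑ A ∈ U.powerset, (crossings A (U \ A)).card

theorem crossingSum_map {α β : Type*} [LinearOrder α] [LinearOrder β] (f : α ↪o β)
    (U : Finset α) : crossingSum (U.map f.toEmbedding) = crossingSum U := by
  symm
  refine Finset.sum_bij (fun A _ => A.map f.toEmbedding) ?_ ?_ ?_ ?_
  · intro A hA
    simpa using hA
  · intro A _ B _ h
    simpa using h
  · intro A hA
    obtain ⟨B, hB, rfl⟩ := Finset.subset_map_iff.1 (Finset.mem_powerset.1 hA)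
    exact ⟨B, Finset.mem_powerset.2 hB, rfl⟩
  · intro A _
    rw [← card_crossings_map f, Finset.map_sdiff]

theorem crossingSum_eq_range (U : Finset ℕ) :
    crossingSum U = crossingSum (Finset.range U.card) := by
  have h (V : Finset ℕ) (m : ℕ) (hV : V.card = m) :
      crossingSum V = crossingSum (Finset.univ : Finset (Fin m)) := by
    rw [← crossingSum_map (V.orderEmbOfFin hV), Finset.map_orderEmbOfFin_univ]
  rw [h U U.card rfl, h (Finset.range U.card) U.card (Finset.card_range _)]

theorem sum_croc (S : Finset ℕ) (k : ℕ) :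
    ∑ P ∈ partitionsOf S (k + 2), croc P =
      ∑ m ∈ Finset.range (S.card + 1),
        S.card.choose m * (S.card - m).stirlingSecond k * crossingSum (Finset.range m) := by
  rw [Finset.sum_congr rfl fun P hP => croc_eq (mem_partitionsOf.1 hP).1,
    sum_partitionsOf_erase S (k + 1) fun A Q => ∑ B ∈ Q, (crossings A B).card]
  have h1 (A : Finset ℕ) : ∑ Q ∈ partitionsOf (S \ A) (k + 1), ∑ B ∈ Q, (crossings A B).card =
      ∑ B ∈ (S \ A).powerset,
        (crossings A B).card * ((S \ A) \ B).card.stirlingSecond k := by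
    rw [sum_partitionsOf_erase (S \ A) k fun B _ => (crossings A B).card, Finset.sum_filter]
    refine Finset.sum_congr rfl fun B _ => ?_
    rcases B.eq_empty_or_nonempty with rfl | hB
    · simp [crossings_empty_right]
    · rw [if_pos hB, Finset.sum_const, card_partitionsOf, smul_eq_mul, mul_comm]
  have h2 : ∑ A ∈ S.powerset with A.Nonempty, ∑ B ∈ (S \ A).powerset,
        (crossings A B).card * ((S \ A) \ B).card.stirlingSecond k =
      ∑ U ∈ S.powerset, (S.card - U.card).stirlingSecond k * crossingSum U := by
    rw [Finset.sum_filter_of_ne]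
    · simp only [crossingSum, Finset.mul_sum]
      rw [Finset.sum_sigma', Finset.sum_sigma']
      refine Finset.sum_bij' (fun x _ => ⟨x.1 ∪ x.2, x.1⟩) (fun x _ => ⟨x.2, x.1 \ x.2⟩)
        ?_ ?_ ?_ ?_ ?_
      · rintro ⟨A, B⟩ h
        simp only [Finset.mem_sigma, Finset.mem_powerset] at h ⊢
        exact ⟨Finset.union_subset h.1 (h.2.trans Finset.sdiff_subset),
          Finset.subset_union_left⟩
      · rintro ⟨U, A⟩ h
        simp only [Finset.mem_sigma, Finset.mem_powerset] at h ⊢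
        exact ⟨h.2.trans h.1, Finset.sdiff_subset_sdiff h.1 le_rfl⟩
      · rintro ⟨A, B⟩ h
        simp only [Finset.mem_sigma, Finset.mem_powerset, Finset.subset_sdiff] at h
        simp only [Finset.union_sdiff_cancel_left h.2.2.symm]
      · rintro ⟨U, A⟩ h
        simp only [Finset.mem_sigma, Finset.mem_powerset] at h
        simp only [Finset.union_sdiff_of_subset h.2]
      · rintro ⟨A, B⟩ h
        simp only [Finset.mem_sigma, Finset.mem_powerset] at h
        have hB := Finset.subset_sdiff.1 h.2
        simp only [Finset.union_sdiff_cancel_left hB.2.symm]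
        rw [Finset.sdiff_sdiff_left', ← Finset.sdiff_union_distrib, Finset.card_sdiff_of_subset
          (Finset.union_subset h.1 hB.1), mul_comm]
    · intro A _ hA
      rw [Finset.nonempty_iff_ne_empty]
      rintro rfl
      simp [crossings_empty_left] at hA
  rw [Finset.sum_congr rfl fun A _ => h1 A, h2,
    Finset.sum_congr rfl fun U _ => by rw [crossingSum_eq_range U],
    Finset.sum_powerset_apply_card fun m =>
      (S.card - m).stirlingSecond k * crossingSum (Finset.range m)]
  simp only [smul_eq_mul, mul_assoc]

/-- The increasing quadruples `a < b < c < d` below `m`, as pairs of crossing chords. -/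
noncomputable def crossingQuads (m : ℕ) : Finset ((ℕ × ℕ) × ℕ × ℕ) :=
  ((Finset.range m ×ˢ Finset.range m) ×ˢ (Finset.range m ×ˢ Finset.range m)).filter fun e =>
    e.1.1 < e.2.1 ∧ e.2.1 < e.1.2 ∧ e.1.2 < e.2.2

theorem mem_crossingQuads {m : ℕ} {e : (ℕ × ℕ) × ℕ × ℕ} :
    e ∈ crossingQuads m ↔
      e.1.1 < e.2.1 ∧ e.2.1 < e.1.2 ∧ e.1.2 < e.2.2 ∧ e.2.2 < m := by
  simp only [crossingQuads, Finset.mem_filter, Finset.mem_product, Finset.mem_range]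
  omega

theorem sum_crossingQuads (m : ℕ) (f : ℕ → ℕ → ℕ → ℕ → ℚ) :
    ∑ e ∈ crossingQuads m, f e.1.1 e.2.1 e.1.2 e.2.2 =
      ∑ d ∈ Finset.range m, ∑ c ∈ Finset.range d, ∑ b ∈ Finset.range c, ∑ a ∈ Finset.range b,
        f a b c d := by
  rw [Finset.sum_sigma', Finset.sum_sigma', Finset.sum_sigma']
  refine Finset.sum_bij' (fun e _ => ⟨⟨⟨e.2.2, e.1.2⟩, e.2.1⟩, e.1.1⟩)
    (fun x _ => ((x.2, x.1.1.2), x.1.2, x.1.1.1)) ?_ ?_ ?_ ?_ ?_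
  · intro e he
    rw [mem_crossingQuads] at he
    simp only [Finset.mem_sigma, Finset.mem_range]
    omega
  · intro x hx
    simp only [Finset.mem_sigma, Finset.mem_range] at hx
    rw [mem_crossingQuads]
    dsimp only
    omega
  · intros; rfl
  · intros; rfl
  · intros; rfl

theorem card_filter_powerset_range {m : ℕ} {p : Finset ℕ → Prop} [DecidablePred p]
    {F D : Finset ℕ}
    (hFD : Disjoint F D)
    (h : ∀ A, (A ∈ (Finset.range m).powerset ∧ p A) ↔ F ⊆ A ∧ A ⊆ F ∪ D) :
    (((Finset.range m).powerset.filter p).card : ℚ) = 2 ^ D.card := by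
  have : (Finset.range m).powerset.filter p = Finset.Icc F (F ∪ D) := by
    ext A
    rw [Finset.mem_filter, h, Finset.mem_Icc]
  rw [this, Finset.card_Icc_finset Finset.subset_union_left, Finset.card_union_of_disjoint hFD,
    Nat.add_sub_cancel_left]
  push_cast
  rfl

theorem card_filter_powerset_range_eq_zero {m : ℕ} {p : Finset ℕ → Prop} [DecidablePred p]
    (h : ∀ A ∈ (Finset.range m).powerset, ¬ p A) :
    (((Finset.range m).powerset.filter p).card : ℚ) = 0 := by
  rw [Finset.filter_false_of_mem h]
  simp

/-- `a, c` lie in `A` and `b, d` do not. -/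
def Alternates (A : Finset ℕ) (a b c d : ℕ) : Prop := (a ∈ A ∧ c ∈ A) ∧ b ∉ A ∧ d ∉ A

/-- No element of `A` is strictly between `i` and `j`. -/
def AvoidsInside (A : Finset ℕ) (i j : ℕ) : Prop := ∀ p ∈ A, ¬(i < p ∧ p < j)

/-- All elements of `A` are between `i` and `j`. -/
def AvoidsOutside (A : Finset ℕ) (i j : ℕ) : Prop := ∀ p ∈ A, i ≤ p ∧ p ≤ j

theorem card_inside_inside {m a b c d : ℕ} (hab : a < b) (hbc : b < c) (hcd : c < d)
    (hdm : d < m) :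
    (((Finset.range m).powerset.filter fun A => Alternates A a b c d ∧
        AvoidsInside A a c ∧
        AvoidsInside (Finset.range m \ A) b d).card : ℚ) =
      if c = b + 1 then 2 ^ a * 2 ^ (m - (d + 1)) else 0 := by
  split_ifs with h
  · rw [card_filter_powerset_range (F := insert a (Finset.Ico c d))
      (D := Finset.range a ∪ Finset.Ico (d + 1) m)]
    · rw [Finset.card_union_of_disjoint, pow_add]
      · simp
      · rw [Finset.disjoint_left]; grind
    · rw [Finset.disjoint_left]; grind
    · intro A
      simp only [Alternates, AvoidsInside, Finset.subset_iff, Finset.mem_powerset,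
        Finset.mem_sdiff, Finset.mem_range, and_imp]
      grind
  · refine card_filter_powerset_range_eq_zero fun A hA => ?_
    simp only [Alternates, AvoidsInside]
    rintro ⟨⟨⟨h1, h2⟩, h3, h4⟩, h5, h6⟩
    have := h5 (b + 1)
    have := h6 (b + 1)
    grind

theorem card_inside_outside {m a b c d : ℕ} (hab : a < b) (hbc : b < c) (hcd : c < d)
    (hdm : d < m) :
    (((Finset.range m).powerset.filter fun A => Alternates A a b c d ∧
        AvoidsInside A a c ∧
        AvoidsOutside (Finset.range m \ A) b d).card : ℚ) =
      if b = a + 1 then 2 ^ (d - (c + 1)) else 0 := by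
  split_ifs with h
  · rw [card_filter_powerset_range (F := Finset.range b ∪ {c} ∪ Finset.Ioo d m)
      (D := Finset.Ico (c + 1) d)]
    · simp
    · rw [Finset.disjoint_left]; grind
    · intro A
      simp only [Alternates, AvoidsInside, AvoidsOutside, Finset.subset_iff, Finset.mem_powerset,
        Finset.mem_sdiff, Finset.mem_range, and_imp]
      grind
  · refine card_filter_powerset_range_eq_zero fun A hA => ?_
    simp only [Alternates, AvoidsInside, AvoidsOutside]
    rintro ⟨⟨⟨h1, h2⟩, h3, h4⟩, h5, h6⟩
    have := h5 (a + 1)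
    have := h6 (a + 1)
    grind

theorem card_outside_inside {m a b c d : ℕ} (hab : a < b) (hbc : b < c) (hcd : c < d)
    (hdm : d < m) :
    (((Finset.range m).powerset.filter fun A => Alternates A a b c d ∧
        AvoidsOutside A a c ∧
        AvoidsInside (Finset.range m \ A) b d).card : ℚ) =
      if d = c + 1 then 2 ^ (b - (a + 1)) else 0 := by
  split_ifs with h
  · rw [card_filter_powerset_range (F := insert a (Finset.Ioc b c))
      (D := Finset.Ico (a + 1) b)]
    · simp
    · rw [Finset.disjoint_left]; grind
    · intro A
      simp only [Alternates, AvoidsInside, AvoidsOutside, Finset.subset_iff, Finset.mem_powerset,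
        Finset.mem_sdiff, Finset.mem_range, and_imp]
      grind
  · refine card_filter_powerset_range_eq_zero fun A hA => ?_
    simp only [Alternates, AvoidsInside, AvoidsOutside]
    rintro ⟨⟨⟨h1, h2⟩, h3, h4⟩, h5, h6⟩
    have := h5 (c + 1)
    have := h6 (c + 1)
    grind

theorem card_outside_outside {m a b c d : ℕ} (hab : a < b) (hbc : b < c) (hcd : c < d)
    (hdm : d < m) :
    (((Finset.range m).powerset.filter fun A => Alternates A a b c d ∧
        AvoidsOutside A a c ∧
        AvoidsOutside (Finset.range m \ A) b d).card : ℚ) =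
      if a = 0 ∧ d + 1 = m then 2 ^ (c - (b + 1)) else 0 := by
  split_ifs with h
  · rw [card_filter_powerset_range (F := Finset.range b ∪ {c})
      (D := Finset.Ico (b + 1) c)]
    · simp
    · rw [Finset.disjoint_left]; grind
    · intro A
      simp only [Alternates, AvoidsOutside, Finset.subset_iff, Finset.mem_powerset,
        Finset.mem_sdiff, Finset.mem_range, and_imp]
      grind
  · refine card_filter_powerset_range_eq_zero fun A hA => ?_
    simp only [Alternates, AvoidsOutside]
    rintro ⟨⟨⟨h1, h2⟩, h3, h4⟩, h5, h6⟩
    have := h5 0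
    have := h6 0
    have := h5 (m - 1)
    have := h6 (m - 1)
    grind

theorem card_left_both_inside {m a b c d : ℕ} (hab : a < b) (hbc : b < c) (hcd : c < d)
    (hdm : d < m) :
    (((Finset.range m).powerset.filter fun A => Alternates A a b c d ∧
        AvoidsInside A a c ∧
        AvoidsOutside A a c ∧
        AvoidsInside (Finset.range m \ A) b d).card : ℚ) =
      if c = b + 1 ∧ d = c + 1 then 1 else 0 := by
  split_ifs with h
  · rw [card_filter_powerset_range (F := {a, c})
      (D := ∅)]
    · simp
    · rw [Finset.disjoint_left]; grind
    · intro A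
      simp only [Alternates, AvoidsInside, AvoidsOutside, Finset.subset_iff, Finset.mem_powerset,
        Finset.mem_sdiff, Finset.mem_range, and_imp]
      grind
  · refine card_filter_powerset_range_eq_zero fun A hA => ?_
    simp only [Alternates, AvoidsInside, AvoidsOutside]
    rintro ⟨⟨⟨h1, h2⟩, h3, h4⟩, h5, h6, h7⟩
    have := h5 (b + 1)
    have := h7 (b + 1)
    have := h6 (c + 1)
    have := h7 (c + 1)
    grind

theorem card_left_both_outside {m a b c d : ℕ} (hab : a < b) (hbc : b < c) (hcd : c < d)
    (hdm : d < m) :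
    (((Finset.range m).powerset.filter fun A => Alternates A a b c d ∧
        AvoidsInside A a c ∧
        AvoidsOutside A a c ∧
        AvoidsOutside (Finset.range m \ A) b d).card : ℚ) =
      if b = a + 1 ∧ a = 0 ∧ d + 1 = m then 1 else 0 := by
  split_ifs with h
  · rw [card_filter_powerset_range (F := {a, c})
      (D := ∅)]
    · simp
    · rw [Finset.disjoint_left]; grind
    · intro A
      simp only [Alternates, AvoidsInside, AvoidsOutside, Finset.subset_iff, Finset.mem_powerset,
        Finset.mem_sdiff, Finset.mem_range, and_imp]
      grind
  · refine card_filter_powerset_range_eq_zero fun A hA => ?_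
    simp only [Alternates, AvoidsInside, AvoidsOutside]
    rintro ⟨⟨⟨h1, h2⟩, h3, h4⟩, h5, h6, h7⟩
    have := h5 (a + 1)
    have := h7 (a + 1)
    have := h6 0
    have := h7 0
    have := h6 (m - 1)
    have := h7 (m - 1)
    grind

theorem card_inside_right_both {m a b c d : ℕ} (hab : a < b) (hbc : b < c) (hcd : c < d)
    (hdm : d < m) :
    (((Finset.range m).powerset.filter fun A => Alternates A a b c d ∧
        AvoidsInside A a c ∧
        AvoidsInside (Finset.range m \ A) b d ∧
        AvoidsOutside (Finset.range m \ A) b d).card : ℚ) =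
      if b = a + 1 ∧ c = b + 1 then 1 else 0 := by
  split_ifs with h
  · rw [card_filter_powerset_range (F := Finset.range m \ {b, d})
      (D := ∅)]
    · simp
    · rw [Finset.disjoint_left]; grind
    · intro A
      simp only [Alternates, AvoidsInside, AvoidsOutside, Finset.subset_iff, Finset.mem_powerset,
        Finset.mem_sdiff, Finset.mem_range, and_imp]
      grind
  · refine card_filter_powerset_range_eq_zero fun A hA => ?_
    simp only [Alternates, AvoidsInside, AvoidsOutside]
    rintro ⟨⟨⟨h1, h2⟩, h3, h4⟩, h5, h6, h7⟩
    have := h5 (a + 1)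
    have := h7 (a + 1)
    have := h5 (b + 1)
    have := h6 (b + 1)
    grind

theorem card_outside_right_both {m a b c d : ℕ} (hab : a < b) (hbc : b < c) (hcd : c < d)
    (hdm : d < m) :
    (((Finset.range m).powerset.filter fun A => Alternates A a b c d ∧
        AvoidsOutside A a c ∧
        AvoidsInside (Finset.range m \ A) b d ∧
        AvoidsOutside (Finset.range m \ A) b d).card : ℚ) =
      if d = c + 1 ∧ a = 0 ∧ d + 1 = m then 1 else 0 := by
  split_ifs with h
  · rw [card_filter_powerset_range (F := Finset.range m \ {b, d})
      (D := ∅)]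
    · simp
    · rw [Finset.disjoint_left]; grind
    · intro A
      simp only [Alternates, AvoidsInside, AvoidsOutside, Finset.subset_iff, Finset.mem_powerset,
        Finset.mem_sdiff, Finset.mem_range, and_imp]
      grind
  · refine card_filter_powerset_range_eq_zero fun A hA => ?_
    simp only [Alternates, AvoidsInside, AvoidsOutside]
    rintro ⟨⟨⟨h1, h2⟩, h3, h4⟩, h5, h6, h7⟩
    have := h5 (c + 1)
    have := h6 (c + 1)
    have := h5 0
    have := h7 0
    have := h5 (m - 1)
    have := h7 (m - 1)
    grind

theorem card_both_both {m a b c d : ℕ} (hab : a < b) (hbc : b < c) (hcd : c < d)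
    (hdm : d < m) :
    (((Finset.range m).powerset.filter fun A => Alternates A a b c d ∧
        AvoidsInside A a c ∧
        AvoidsOutside A a c ∧
        AvoidsInside (Finset.range m \ A) b d ∧
        AvoidsOutside (Finset.range m \ A) b d).card : ℚ) =
      if (b = a + 1 ∧ c = b + 1 ∧ d = c + 1) ∧ a = 0 ∧ d + 1 = m then 1 else 0 := by
  split_ifs with h
  · rw [card_filter_powerset_range (F := {a, c})
      (D := ∅)]
    · simp
    · rw [Finset.disjoint_left]; grind
    · intro A
      simp only [Alternates, AvoidsInside, AvoidsOutside, Finset.subset_iff, Finset.mem_powerset,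
        Finset.mem_sdiff, Finset.mem_range, and_imp]
      grind
  · refine card_filter_powerset_range_eq_zero fun A hA => ?_
    simp only [Alternates, AvoidsInside, AvoidsOutside]
    rintro ⟨⟨⟨h1, h2⟩, h3, h4⟩, h5, h6, h7, h8⟩
    have := h5 (a + 1)
    have := h8 (a + 1)
    have := h5 (b + 1)
    have := h7 (b + 1)
    have := h6 (c + 1)
    have := h7 (c + 1)
    have := h6 0
    have := h8 0
    have := h6 (m - 1)
    have := h8 (m - 1)
    grind

theorem card_crossing_subsets {m a b c d : ℕ} (hab : a < b) (hbc : b < c) (hcd : c < d)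
    (hdm : d < m) :
    (((Finset.range m).powerset.filter fun A => Alternates A a b c d ∧
        IsSide A a c ∧ IsSide (Finset.range m \ A) b d).card : ℚ) =
      (if c = b + 1 then 2 ^ a * 2 ^ (m - (d + 1)) else 0) +
      (if b = a + 1 then 2 ^ (d - (c + 1)) else 0) +
      (if d = c + 1 then 2 ^ (b - (a + 1)) else 0) +
      (if a = 0 ∧ d + 1 = m then 2 ^ (c - (b + 1)) else 0) -
      (if c = b + 1 ∧ d = c + 1 then 1 else 0) -
      (if b = a + 1 ∧ a = 0 ∧ d + 1 = m then 1 else 0) -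
      (if b = a + 1 ∧ c = b + 1 then 1 else 0) -
      (if d = c + 1 ∧ a = 0 ∧ d + 1 = m then 1 else 0) +
      (if (b = a + 1 ∧ c = b + 1 ∧ d = c + 1) ∧ a = 0 ∧ d + 1 = m then 1 else 0) := by
  rw [← card_inside_inside hab hbc hcd hdm, ← card_inside_outside hab hbc hcd hdm,
    ← card_outside_inside hab hbc hcd hdm, ← card_outside_outside hab hbc hcd hdm,
    ← card_left_both_inside hab hbc hcd hdm, ← card_left_both_outside hab hbc hcd hdm,
    ← card_inside_right_both hab hbc hcd hdm, ← card_outside_right_both hab hbc hcd hdm,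
    ← card_both_both hab hbc hcd hdm]
  simp only [Finset.natCast_card_filter]
  simp only [← Finset.sum_add_distrib, ← Finset.sum_sub_distrib]
  refine Finset.sum_congr rfl fun A _ => ?_
  have hs (B : Finset ℕ) (i j : ℕ) : IsSide B i j ↔ AvoidsInside B i j ∨ AvoidsOutside B i j :=
    Iff.rfl
  rw [hs, hs]
  by_cases h : Alternates A a b c d <;> by_cases h1 : AvoidsInside A a c <;>
    by_cases h2 : AvoidsOutside A a c <;> by_cases h3 : AvoidsInside (Finset.range m \ A) b d <;>
    by_cases h4 : AvoidsOutside (Finset.range m \ A) b d <;> simp [h, h1, h2, h3, h4]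

theorem crossingSum_range (m : ℕ) :
    (crossingSum (Finset.range m) : ℚ) =
      ∑ e ∈ crossingQuads m, (((Finset.range m).powerset.filter fun A =>
        Alternates A e.1.1 e.2.1 e.1.2 e.2.2 ∧ IsSide A e.1.1 e.1.2 ∧
          IsSide (Finset.range m \ A) e.2.1 e.2.2).card : ℚ) := by
  simp only [crossingSum, Nat.cast_sum, Finset.natCast_card_filter]
  rw [Finset.sum_comm]
  refine Finset.sum_congr rfl fun A hA => ?_
  rw [← Finset.natCast_card_filter]
  congr 2
  ext e
  have hA' (x : ℕ) (hx : x ∈ A) : x < m := Finset.mem_range.1 (Finset.mem_powerset.1 hA hx)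
  rw [mem_crossings, Finset.mem_filter, mem_crossingQuads, Alternates]
  simp only [Finset.mem_sdiff, Finset.mem_range]
  constructor
  · rintro ⟨⟨h1, h2, h3⟩, h4, h5⟩
    exact ⟨⟨h4.1, h4.2.1, h4.2.2, h3.1⟩, ⟨h1, h2.2, h3.2⟩, h5⟩
  · rintro ⟨⟨h1, h2, h3, h4⟩, ⟨h5, h6, h7⟩, h8⟩
    exact ⟨⟨h5, ⟨by omega, h6⟩, h4, h7⟩, ⟨h1, h2, h3⟩, h8⟩

/-- The sum of `f a b c d` over `a < b < c < d < m`. -/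
noncomputable def quadSum (m : ℕ) (f : ℕ → ℕ → ℕ → ℕ → ℚ) : ℚ :=
  ∑ d ∈ Finset.range m, ∑ c ∈ Finset.range d, ∑ b ∈ Finset.range c,
    ∑ a ∈ Finset.range b, f a b c d

theorem quadSum_eq_zero {m : ℕ} (hm : m ≤ 3) (f : ℕ → ℕ → ℕ → ℕ → ℚ) : quadSum m f = 0 := by
  interval_cases m <;> simp [quadSum, Finset.sum_range_succ]

theorem quadSum_add_three (M : ℕ) (f : ℕ → ℕ → ℕ → ℕ → ℚ) :
    quadSum (M + 3) f =
      ∑ d ∈ Finset.range M, ∑ c ∈ Finset.range (d + 1), ∑ b ∈ Finset.range (c + 1),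
        ∑ a ∈ Finset.range (b + 1), f a (b + 1) (c + 2) (d + 3) := by
  simp [quadSum, Finset.sum_range_succ']

theorem sum_two_pow (n : ℕ) : ∑ i ∈ Finset.range n, (2 : ℚ) ^ i = 2 ^ n - 1 := by
  induction n with
  | zero => simp
  | succ n ih => rw [Finset.sum_range_succ, ih]; ring

theorem sum_two_pow_sub (n : ℕ) :
    ∑ i ∈ Finset.range (n + 1), (2 : ℚ) ^ (n - i) = 2 ^ (n + 1) - 1 := by
  rw [← sum_two_pow, ← Finset.sum_range_reflect]
  refine Finset.sum_congr rfl fun i hi => ?_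
  congr 1
  have := Finset.mem_range.1 hi
  omega

theorem sum_two_pow_sub_one (n : ℕ) :
    ∑ i ∈ Finset.range n, ((2 : ℚ) ^ (i + 1) - 1) = 2 ^ (n + 1) - 2 - n := by
  induction n with
  | zero => simp
  | succ n ih => rw [Finset.sum_range_succ, ih]; push_cast; ring

theorem sum_natCast_range (n : ℕ) : ∑ i ∈ Finset.range n, (i : ℚ) = n * (n - 1) / 2 := by
  induction n with
  | zero => simp
  | succ n ih => rw [Finset.sum_range_succ, ih]; push_cast; ring

theorem sum_mul_two_pow_sub (M : ℕ) (u : ℕ → ℚ) :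
    ∑ d ∈ Finset.range (M + 1), u d * 2 ^ (M - d) =
      2 * ∑ d ∈ Finset.range M, u d * 2 ^ (M - (d + 1)) + u M := by
  rw [Finset.sum_range_succ, Finset.mul_sum, Nat.sub_self, pow_zero, mul_one]
  congr 1
  refine Finset.sum_congr rfl fun d hd => ?_
  obtain ⟨e, rfl⟩ := Nat.exists_eq_add_of_lt (Finset.mem_range.1 hd)
  rw [show d + e + 1 - d = e + 1 by omega, show d + e + 1 - (d + 1) = e by omega]
  ring

theorem quadSum_inside_inside (M : ℕ) :
    quadSum (M + 3) (fun a b c d => if c = b + 1 then 2 ^ a * 2 ^ (M + 3 - (d + 1)) else 0) =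
      (2 * M - 4) * 2 ^ M + M + 4 := by
  have h : ∑ d ∈ Finset.range M, ((2 : ℚ) ^ (d + 2) - 3 - d) * 2 ^ (M - (d + 1)) =
      (2 * M - 4) * 2 ^ M + M + 4 := by
    induction M with
    | zero => norm_num
    | succ M ih =>
      simp only [Nat.add_sub_add_right]
      rw [sum_mul_two_pow_sub, ih]
      push_cast
      ring
  rw [quadSum_add_three, ← h]
  refine Finset.sum_congr rfl fun d _ => ?_
  rw [show M + 3 - (d + 3 + 1) = M - (d + 1) by omega]
  have (c : ℕ) : ∑ b ∈ Finset.range (c + 1), ∑ a ∈ Finset.range (b + 1),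
      (if c + 2 = b + 1 + 1 then (2 : ℚ) ^ a * 2 ^ (M - (d + 1)) else 0) =
      (2 ^ (c + 1) - 1) * 2 ^ (M - (d + 1)) := by
    rw [Finset.sum_eq_single c]
    · simp [← Finset.sum_mul, sum_two_pow]
    · intro b _ hb
      simp [hb.symm]
    · simp
  simp only [this, ← Finset.sum_mul, sum_two_pow_sub_one]
  push_cast
  ring

theorem quadSum_inside_outside (M : ℕ) :
    quadSum (M + 3) (fun a b c d => if b = a + 1 then 2 ^ (d - (c + 1)) else 0) =
      2 ^ (M + 2) - 1 - (M + 2) * (M + 1) / 2 - (M + 2) := by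
  have h (d : ℕ) : ∑ c ∈ Finset.range (d + 1), ((c : ℚ) + 1) * 2 ^ (d - c) =
      2 ^ (d + 2) - d - 3 := by
    induction d with
    | zero => norm_num
    | succ d ih =>
      rw [sum_mul_two_pow_sub]
      simp only [Nat.add_sub_add_right]
      rw [ih]
      push_cast
      ring
  have h' (d c : ℕ) : d + 3 - (c + 2 + 1) = d - c := by omega
  rw [quadSum_add_three]
  simp [h', h]
  induction M with
  | zero => norm_num
  | succ M ih =>
    simp [Finset.sum_range_succ]
    linear_combination ih

theorem quadSum_outside_inside (M : ℕ) :
    quadSum (M + 3) (fun a b c d => if d = c + 1 then 2 ^ (b - (a + 1)) else 0) =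
      2 ^ (M + 2) - 1 - (M + 2) * (M + 1) / 2 - (M + 2) := by
  rw [quadSum_add_three]
  have (c d : ℕ) : ∑ b ∈ Finset.range (c + 1), ∑ a ∈ Finset.range (b + 1),
      (if d + 3 = c + 2 + 1 then (2 : ℚ) ^ (b + 1 - (a + 1)) else 0) =
      if d = c then (2 : ℚ) ^ (c + 2) - 2 - (c + 1) else 0 := by
    split_ifs with h1 h2 h2
    · simp only [Nat.add_sub_add_right, sum_two_pow_sub, sum_two_pow_sub_one]
      push_cast
      ring
    · omega
    · omega
    · simp
  simp only [this]
  simp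
  induction M with
  | zero => norm_num
  | succ M ih =>
    simp [Finset.sum_range_succ]
    linear_combination ih

theorem quadSum_outside_outside (M : ℕ) :
    quadSum (M + 3) (fun a b c d => if a = 0 ∧ d + 1 = M + 3 then 2 ^ (c - (b + 1)) else 0) =
      2 ^ (M + 1) - 1 - (M + 1) := by
  rw [quadSum_add_three]
  rcases M with _ | M
  · norm_num
  · rw [Finset.sum_eq_single M]
    · have (b c : ℕ) : c + 2 - (b + 1 + 1) = c - b := by omega
      simp only [ite_and, Finset.sum_ite_eq', Finset.mem_range, Nat.succ_pos, if_true, this,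
        sum_two_pow_sub, sum_two_pow_sub_one]
      push_cast
      ring
    · intro d _ hd
      simp [hd]
    · simp

theorem quadSum_left_both_inside (M : ℕ) :
    quadSum (M + 3) (fun _ b c d => if c = b + 1 ∧ d = c + 1 then 1 else 0) =
      M * (M + 1) / 2 := by
  rw [quadSum_add_three]
  simp [ite_and]
  rw [Finset.sum_add_distrib, sum_natCast_range]
  simp
  ring

theorem quadSum_left_both_outside (M : ℕ) :
    quadSum (M + 3) (fun a b _ d => if b = a + 1 ∧ a = 0 ∧ d + 1 = M + 3 then 1 else 0) = M := by
  rw [quadSum_add_three]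
  simp [ite_and]
  rcases M with _ | M <;> simp

theorem quadSum_inside_right_both (M : ℕ) :
    quadSum (M + 3) (fun a b c _ => if b = a + 1 ∧ c = b + 1 then 1 else 0) =
      M * (M + 1) / 2 := by
  rw [quadSum_add_three]
  simp [ite_and]
  rw [Finset.sum_add_distrib, sum_natCast_range]
  simp
  ring

theorem quadSum_outside_right_both (M : ℕ) :
    quadSum (M + 3) (fun a _ c d => if d = c + 1 ∧ a = 0 ∧ d + 1 = M + 3 then 1 else 0) = M := by
  rw [quadSum_add_three]
  simp [ite_and]
  rcases M with _ | M <;> simp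

theorem quadSum_both_both (M : ℕ) :
    quadSum (M + 3) (fun a b c d =>
      if (b = a + 1 ∧ c = b + 1 ∧ d = c + 1) ∧ a = 0 ∧ d + 1 = M + 3 then 1 else 0) =
      if M = 1 then 1 else 0 := by
  rw [quadSum_add_three]
  simp [ite_and]
  grind

theorem crossingSum_range_eq_quadSum (m : ℕ) :
    (crossingSum (Finset.range m) : ℚ) =
      quadSum m (fun a b c d => if c = b + 1 then 2 ^ a * 2 ^ (m - (d + 1)) else 0) +
      quadSum m (fun a b c d => if b = a + 1 then 2 ^ (d - (c + 1)) else 0) +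
      quadSum m (fun a b c d => if d = c + 1 then 2 ^ (b - (a + 1)) else 0) +
      quadSum m (fun a b c d => if a = 0 ∧ d + 1 = m then 2 ^ (c - (b + 1)) else 0) -
      quadSum m (fun _ b c d => if c = b + 1 ∧ d = c + 1 then 1 else 0) -
      quadSum m (fun a b _ d => if b = a + 1 ∧ a = 0 ∧ d + 1 = m then 1 else 0) -
      quadSum m (fun a b c _ => if b = a + 1 ∧ c = b + 1 then 1 else 0) -
      quadSum m (fun a _ c d => if d = c + 1 ∧ a = 0 ∧ d + 1 = m then 1 else 0) +
      quadSum m (fun a b c d =>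
        if (b = a + 1 ∧ c = b + 1 ∧ d = c + 1) ∧ a = 0 ∧ d + 1 = m then 1 else 0) := by
  rw [crossingSum_range]
  simp only [quadSum, ← sum_crossingQuads, ← Finset.sum_add_distrib, ← Finset.sum_sub_distrib]
  refine Finset.sum_congr rfl fun e he => ?_
  obtain ⟨h1, h2, h3, h4⟩ := mem_crossingQuads.1 he
  exact card_crossing_subsets h1 h2 h3 h4

theorem crossingSum_range_closed (m : ℕ) :
    (crossingSum (Finset.range m) : ℚ) =
      1 / 4 * (m * 2 ^ m) + (-2) * (m * m) + 4 * m + (-(5 / 2)) * (if m = 1 then 1 else 0) +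
        (-2) * (if m = 2 then 1 else 0) + (if m = 4 then 1 else 0) := by
  rw [crossingSum_range_eq_quadSum]
  obtain hm | ⟨M, rfl⟩ : m < 3 ∨ ∃ M, m = M + 3 := by
    rcases Nat.lt_or_ge m 3 with h | h
    · exact .inl h
    · exact .inr ⟨m - 3, by omega⟩
  · simp only [quadSum_eq_zero hm.le]
    interval_cases m <;> norm_num
  · rw [quadSum_inside_inside, quadSum_inside_outside, quadSum_outside_inside,
      quadSum_outside_outside, quadSum_left_both_inside, quadSum_left_both_outside,
      quadSum_inside_right_both, quadSum_outside_right_both, quadSum_both_both]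
    have h1 : M + 3 ≠ 1 := by omega
    have h2 : M + 3 ≠ 2 := by omega
    have h4 : M + 3 = 4 ↔ M = 1 := by omega
    simp only [h1, h2, h4, if_false]
    push_cast
    ring

theorem sum_croc_eq_stirlingConv (n j : ℕ) :
    ∑ π ∈ partitionsK n (j + 2), (croc π : ℚ) =
      stirlingConv n j fun m => (crossingSum (Finset.range m) : ℚ) := by
  have := sum_croc (seg n) j
  rw [partitionsK_eq, stirlingConv, ← Nat.cast_sum, this, seg, Nat.card_Icc, Nat.add_sub_cancel]
  push_cast
  rfl

theorem sum_croc_partitionsK (N j : ℕ) :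
    ∑ π ∈ partitionsK (N + 4) (j + 2), (croc π : ℚ) =
      (N + 4) * (j + 1) / 2 * (N + 4).stirlingSecond (j + 2) +
        (N + 4) / 2 * (5 * j - 4 * N - 7) * (N + 3).stirlingSecond (j + 1) -
        (N + 4) * (N + 3) * (N + 2).stirlingSecond j + (N + 4).choose 4 * N.stirlingSecond j := by
  have hid (M : ℕ) : stirlingConv (M + 1) j (fun m => (m : ℚ)) =
      (M + 1) * (M + 1).stirlingSecond (j + 1) := by
    rw [← stirlingConv_one, ← stirlingConv_id_mul M j fun _ => 1]
    simp only [mul_one]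
  have hsq : stirlingConv (N + 4) j (fun m => (m : ℚ) * m) =
      (N + 4) * ((N + 3) * (N + 3).stirlingSecond (j + 1) + (N + 4).stirlingSecond (j + 1)) := by
    rw [stirlingConv_id_mul]
    simp only [Nat.cast_succ]
    rw [stirlingConv_add, hid, stirlingConv_one]
    push_cast
    ring
  have hpow : stirlingConv (N + 4) j (fun m => (m : ℚ) * 2 ^ m) =
      (N + 4) * (2 * ((j + 1) * (N + 4).stirlingSecond (j + 2) +
        (N + 4).stirlingSecond (j + 1))) := by
    rw [stirlingConv_id_mul]
    simp only [pow_succ']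
    rw [stirlingConv_const_mul, stirlingConv_two_pow]
    push_cast
    ring
  rw [sum_croc_eq_stirlingConv]
  simp only [crossingSum_range_closed]
  simp only [stirlingConv_add, stirlingConv_const_mul]
  rw [hpow, hsq, hid, stirlingConv_single j (by omega), stirlingConv_single j (by omega),
    stirlingConv_single j (by omega), Nat.cast_choose_two, Nat.choose_one_right,
    Nat.stirlingSecond_succ_succ (N + 3) j]
  simp only [Nat.add_sub_cancel, show N + 4 - 1 = N + 3 by omega,
    show N + 4 - 2 = N + 2 by omega]
  push_cast
  ring

/-- exact total and average number of circular crossings over `Π_n^k`. -/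
theorem croc_mean_over_partitionsK (n k : ℕ) (hn : 4 ≤ n) (hk : 2 ≤ k) :
    (∑ π ∈ partitionsK n k, (croc π : ℚ))
        = ((n : ℚ) * ((k : ℚ) - 1) / 2) * (stirling n k : ℚ)
            + ((n : ℚ)/2) * (5*(k : ℚ) - 4*(n : ℚ) - 1) * (stirling (n-1) (k-1) : ℚ)
            - (n : ℚ) * ((n : ℚ) - 1) * (stirling (n-2) (k-2) : ℚ)
            + (n.choose 4 : ℚ) * (stirling (n-4) (k-2) : ℚ) ∧
    (∑ π ∈ partitionsK n k, (croc π : ℚ)) / (stirling n k : ℚ)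
        = (((n : ℚ) * ((k : ℚ) - 1) / 2) * (stirling n k : ℚ)
            + ((n : ℚ)/2) * (5*(k : ℚ) - 4*(n : ℚ) - 1) * (stirling (n-1) (k-1) : ℚ)
            - (n : ℚ) * ((n : ℚ) - 1) * (stirling (n-2) (k-2) : ℚ)
            + (n.choose 4 : ℚ) * (stirling (n-4) (k-2) : ℚ)) / (stirling n k : ℚ) := by
  obtain ⟨N, rfl⟩ := Nat.exists_eq_add_of_le' hn
  obtain ⟨j, rfl⟩ := Nat.exists_eq_add_of_le' hk
  refine (fun h => ⟨h, congrArg (· / (stirling (N + 4) (j + 2) : ℚ)) h⟩) ?_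
  rw [sum_croc_partitionsK]
  simp only [stirling_eq, Nat.add_sub_cancel, show N + 4 - 1 = N + 3 by omega,
    show N + 4 - 2 = N + 2 by omega, show j + 2 - 1 = j + 1 by omega]
  push_cast
  ring
end
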